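/- arXiv:1410.6179 — 3 statements merged into one kernel-verified Lean document; each statement's English description precedes it below -/
import Mathlib

section
/- Let p = 2, k ≥ 2, 0 ≤ n, and m − n ≥ 5. Let χ1,…,χk be primitive characters mod 2^m (so all c_i are odd) and suppose χ1⋯χk is induced by a primitive character mod 2^{m−n}; in particular 2^n exactly divides c1+⋯+ck. Set v := (c1+⋯+ck)/2^n. Then J_{2^n}(χ1,…,χk,2^m) = 2^{(m(k−1)+n)/2} · χ1(c1)⋯χk(ck) · (χ1⋯χk(v))^{−1} · δ, where δ = (2/v)^{m−n} · (2/(c1⋯ck))^m · ω^{(2^n−1)v}. -/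
open Complex

/-- The generalized Jacobi sum `J_B(χ₁,…,χ_k, q)`. -/
noncomputable def Jsum {q : ℕ} [NeZero q] {k : ℕ}
    (χ : Fin k → DirichletCharacter ℂ q) (B : ZMod q) : ℂ :=
  ∑ x : Fin k → ZMod q, if (∑ i, x i) = B then ∏ i, χ i (x i) else 0

/-- `ω = e^{πi/4}`. -/
noncomputable def omega : ℂ := Complex.exp (Real.pi * Complex.I / 4)

theorem five_pow_two_pow (T : ℕ) (hT : 2 ≤ T) :
    ∃ R : ℤ, (5 : ℤ) ^ 2 ^ T = 1 + 2 ^ (T + 2) * (8 * R - 1) := by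
  induction T, hT using Nat.le_induction with
  | base => exact ⟨5, by norm_num⟩
  | succ T hT ih =>
    obtain ⟨R, hR⟩ := ih
    obtain ⟨t, rfl⟩ := Nat.exists_eq_add_of_le hT
    refine ⟨R + 2 ^ t * (8 * R - 1) ^ 2, ?_⟩
    rw [pow_succ, pow_mul, hR]
    ring

theorem one_add_pow_two_pow_approx {s : ℕ} (hs : 2 ≤ s) (u : ℤ) (hu : 2 ^ s ∣ u) (T : ℕ) :
    ∃ w : ℤ, (1 + u) ^ 2 ^ T = 1 + w ∧ 2 ^ (s + T) ∣ w ∧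
      2 ^ (3 * s + T + 1) ∣ (2 * w - w ^ 2) - 2 ^ T * (2 * u - u ^ 2) := by
  induction T with
  | zero => exact ⟨u, by simp, by simpa using hu, by simp⟩
  | succ T ih =>
    obtain ⟨w, hw, ⟨b, hb⟩, hf⟩ := ih
    refine ⟨2 * w + w ^ 2, by rw [pow_succ, pow_mul, hw]; ring, ⟨b + 2 ^ (s + T - 1) * b ^ 2, ?_⟩, ?_⟩
    · obtain ⟨t, rfl⟩ := Nat.exists_eq_add_of_le hs
      rw [hb, show 2 + t + T - 1 = 1 + t + T by omega]
      ring
    · have h1 : 2 * (2 * w + w ^ 2) - (2 * w + w ^ 2) ^ 2 - 2 ^ (T + 1) * (2 * u - u ^ 2) =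
          2 * ((2 * w - w ^ 2) - 2 ^ T * (2 * u - u ^ 2)) - (4 * w ^ 3 + w ^ 4) := by ring
      rw [h1]
      refine dvd_sub ?_ ?_
      · rw [show 3 * s + (T + 1) + 1 = (3 * s + T + 1) + 1 by ring, pow_succ']
        exact mul_dvd_mul_left _ hf
      · obtain ⟨t, rfl⟩ := Nat.exists_eq_add_of_le hs
        refine ⟨2 ^ (2 * T) * b ^ 3 + 2 ^ (3 * T + t) * b ^ 4, ?_⟩
        rw [hb]
        ring

theorem one_add_pow_linear_approx {j : ℕ} (u : ℤ) (hu : 2 ^ j ∣ u) (L : ℕ) :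
    2 ^ (2 * j) ∣ (1 + u) ^ L - (1 + L * u) := by
  have h : u ^ 2 ∣ (1 + u) ^ L - (1 + L * u) := by
    induction L with
    | zero => simp
    | succ L ih =>
      obtain ⟨b, hb⟩ := ih
      refine ⟨b * (1 + u) + L, ?_⟩
      rw [pow_succ, eq_add_of_sub_eq hb]
      push_cast
      ring
  refine dvd_trans ?_ h
  rw [mul_comm, pow_mul]
  exact pow_dvd_pow_of_dvd hu 2

theorem exists_five_pow_dvd (m : ℕ) (x : ℤ) (hx : 4 ∣ x - 1) :
    ∃ L : ℕ, (2 : ℤ) ^ m ∣ 5 ^ L - x := by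
  rcases lt_or_ge m 4 with hm | hm
  · have key : ∃ L : ℕ, (2 : ℤ) ^ 3 ∣ 5 ^ L - x := by
      have : x % 8 = 1 ∨ x % 8 = 5 := by omega
      rcases this with h | h
      · exact ⟨0, by norm_num; omega⟩
      · exact ⟨1, by norm_num; omega⟩
    obtain ⟨L, hL⟩ := key
    exact ⟨L, (pow_dvd_pow 2 (by omega)).trans hL⟩
  · induction m, hm using Nat.le_induction with
    | base =>
      have : x % 16 = 1 ∨ x % 16 = 5 ∨ x % 16 = 9 ∨ x % 16 = 13 := by omega
      rcases this with h | h | h | h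
      · exact ⟨0, by norm_num; omega⟩
      · exact ⟨1, by norm_num; omega⟩
      · exact ⟨2, by norm_num; omega⟩
      · exact ⟨3, by norm_num; omega⟩
    | succ m hm ih =>
      obtain ⟨L, w, hw⟩ := ih
      rcases Int.even_or_odd w with ⟨t, ht⟩ | ho
      · exact ⟨L, t, by rw [hw, ht]; ring⟩
      · obtain ⟨R, hR⟩ := five_pow_two_pow (m - 2) (by omega)
        rw [Nat.sub_add_cancel (by omega)] at hR
        have hxo : Odd x := by rw [Int.odd_iff]; omega
        have h2 : Even (w + (x + 2 ^ m * w) * (8 * R - 1)) := by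
          refine ho.add_odd (Odd.mul ?_ ?_)
          · refine hxo.add_even ((Even.pow_of_ne_zero even_two (by omega)).mul_right w)
          · exact ⟨4 * R - 1, by ring⟩
        obtain ⟨t, ht⟩ := h2
        refine ⟨L + 2 ^ (m - 2), t, ?_⟩
        rw [pow_add, hR, eq_add_of_sub_eq hw]
        linear_combination 2 ^ m * ht

/-- A quadratic approximation to the discrete logarithm to base `5`, with a uniform scaling `r`. -/
theorem exists_discrete_log_approx (m : ℕ) : ∃ r : ℤ, 8 ∣ r - 1 ∧
    ∀ (s M L : ℕ) (y : ℤ), 2 ≤ s → s ≤ m → M ≤ m → M ≤ 3 * s →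
      2 ^ m ∣ 5 ^ L - (1 + 2 ^ s * y) →
      2 ^ M ∣ 4 * L + r * (2 ^ s * y - 2 ^ (2 * s - 1) * y ^ 2) := by
  obtain ⟨R, hR⟩ := five_pow_two_pow (m + 2) (by omega)
  have hcop : IsCoprime (8 * R - 1) ((2 : ℤ) ^ (m + 3)) :=
    IsCoprime.pow_right ⟨-1, 4 * R, by ring⟩
  obtain ⟨a, b, hab⟩ := hcop
  refine ⟨-a, ?_, ?_⟩
  · exact ⟨-a * R - 2 ^ m * b, by rw [pow_add] at hab; linear_combination hab⟩
  intro s M L y hs hsm hMm hMs ⟨k, hk⟩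
  obtain ⟨e, rfl⟩ := Nat.exists_eq_add_of_le hsm
  obtain ⟨t, rfl⟩ := Nat.exists_eq_add_of_le hs
  set m := 2 + t + e with hm
  set Y := y + 2 ^ e * k with hY
  have h5 : (5 : ℤ) ^ L = 1 + 2 ^ (2 + t) * Y := by
    rw [eq_add_of_sub_eq hk, hY, hm]; ring
  obtain ⟨w, hw, -, hf⟩ := one_add_pow_two_pow_approx hs (2 ^ (2 + t) * Y) ⟨Y, rfl⟩ (m + 2)
  have hlin := one_add_pow_linear_approx (j := m + 4) (2 ^ (m + 4) * (8 * R - 1)) ⟨_, rfl⟩ L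
  rw [← h5, ← pow_mul, mul_comm L, pow_mul, hR] at hw
  rw [show m + 2 + 2 = m + 4 from rfl] at hw
  rw [hw] at hlin
  obtain ⟨g, hg⟩ := hlin
  obtain ⟨f, hf⟩ := hf
  have hwv : w = 2 ^ (m + 4) * (L * (8 * R - 1) + 2 ^ (m + 4) * g) := by
    linear_combination hg
  have hdiv : (2 : ℤ) ^ M ∣ (2 ^ (2 + t) * Y - 2 ^ (3 + 2 * t) * Y ^ 2) - 4 * L * (8 * R - 1) := by
    have h1 : (2 : ℤ) ^ (m + 3) * ((2 ^ (2 + t) * Y - 2 ^ (3 + 2 * t) * Y ^ 2) - 4 * L * (8 * R - 1))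
        = 2 ^ (m + 3) * (4 * 2 ^ (m + 4) * g
          - 2 ^ (m + 4) * 2 * (L * (8 * R - 1) + 2 ^ (m + 4) * g) ^ 2 - 2 ^ (3 * (2 + t)) * f) := by
      rw [hwv] at hf
      have e1 : (2 : ℤ) ^ (3 * (2 + t) + (m + 2) + 1) = 2 ^ (m + 3) * 2 ^ (3 * (2 + t)) := by ring
      rw [e1] at hf
      linear_combination -hf
    have h2 := mul_left_cancel₀ (by positivity) h1
    rw [h2]
    refine dvd_sub (dvd_sub ?_ ?_) ?_
    · exact ((pow_dvd_pow 2 (by omega)).mul_left 4).mul_right g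
    · exact ((pow_dvd_pow 2 (by omega)).mul_right 2).mul_right _
    · exact (pow_dvd_pow 2 hMs).mul_right _
  have hYy : (2 : ℤ) ^ M ∣ (2 ^ (2 + t) * Y - 2 ^ (3 + 2 * t) * Y ^ 2) -
      (2 ^ (2 + t) * y - 2 ^ (3 + 2 * t) * y ^ 2) := by
    refine (pow_dvd_pow 2 hMm).trans ⟨k - 2 ^ (2 + t) * y * k - 2 ^ (1 + t + e) * k ^ 2, ?_⟩
    rw [hY, hm]; ring
  rw [show 2 * (2 + t) - 1 = 3 + 2 * t by omega]
  have h3 : (2 : ℤ) ^ M ∣ 2 ^ (m + 3) := pow_dvd_pow 2 (by omega)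
  have : 4 * (L : ℤ) + -a * (2 ^ (2 + t) * y - 2 ^ (3 + 2 * t) * y ^ 2) =
      a * (((2 ^ (2 + t) * Y - 2 ^ (3 + 2 * t) * Y ^ 2) -
      (2 ^ (2 + t) * y - 2 ^ (3 + 2 * t) * y ^ 2)) -
      ((2 ^ (2 + t) * Y - 2 ^ (3 + 2 * t) * Y ^ 2) - 4 * L * (8 * R - 1))) + 2 ^ (m + 3) * (4 * L * b) := by
    linear_combination -4 * (L : ℤ) * hab
  rw [this]
  exact dvd_add ((dvd_sub hYy hdiv).mul_left a) (h3.mul_right _)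

theorem two_pow_self_eq_zero (m : ℕ) : (2 : ZMod (2 ^ m)) ^ m = 0 := by
  exact_mod_cast ZMod.natCast_self (2 ^ m)

open ZMod in
theorem apply_one_add_of_discrete_log {m n M : ℕ} [NeZero (2 ^ m)] (hm : m = M + n)
    (χ : DirichletCharacter ℂ (2 ^ m)) (c r : ℤ)
    (h5 : χ 5 = stdAddChar (2 ^ n * 4 * c : ZMod (2 ^ m)))
    (hr : ∀ (s M L : ℕ) (y : ℤ), 2 ≤ s → s ≤ m → M ≤ m → M ≤ 3 * s →
      2 ^ m ∣ 5 ^ L - (1 + 2 ^ s * y) →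
      2 ^ M ∣ 4 * L + r * (2 ^ s * y - 2 ^ (2 * s - 1) * y ^ 2))
    {s : ℕ} (hs : 2 ≤ s) (hsm : s ≤ m) (hMs : M ≤ 3 * s) (y : ZMod (2 ^ m)) :
    χ (1 + 2 ^ s * y) =
      stdAddChar (-(2 ^ n * (r * c) * (2 ^ s * y - 2 ^ (2 * s - 1) * y ^ 2)) : ZMod (2 ^ m)) := by
  obtain ⟨y, rfl⟩ := ZMod.intCast_surjective y
  obtain ⟨t, rfl⟩ := Nat.exists_eq_add_of_le hs
  obtain ⟨L, hL⟩ := exists_five_pow_dvd m (1 + 2 ^ (2 + t) * y) ⟨2 ^ t * y, by ring⟩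
  obtain ⟨k, hk⟩ := hr (2 + t) M L y hs hsm (by omega) hMs hL
  have hx : (1 + 2 ^ (2 + t) * (y : ZMod (2 ^ m))) = 5 ^ L := by
    have := (ZMod.intCast_zmod_eq_zero_iff_dvd (5 ^ L - (1 + 2 ^ (2 + t) * y)) (2 ^ m)).2
      (by exact_mod_cast hL)
    push_cast at this
    exact (sub_eq_zero.1 this).symm
  rw [hx, map_pow, h5, ← AddChar.map_nsmul_eq_pow]
  congr 1
  have hz : ((2 : ZMod (2 ^ m)) ^ m) = 0 := two_pow_self_eq_zero m
  have hk' := congrArg (Int.cast : ℤ → ZMod (2 ^ m)) hk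
  push_cast at hk'
  have hMn : (2 : ZMod (2 ^ m)) ^ M * 2 ^ n = 0 := by rw [← pow_add, ← hm, hz]
  rw [nsmul_eq_mul]
  linear_combination 2 ^ n * c * hk' + c * k * hMn

theorem isUnit_one_add_two_pow_mul {m s : ℕ} (hs : 1 ≤ s) (y : ZMod (2 ^ m)) :
    IsUnit (1 + 2 ^ s * y) := by
  refine IsNilpotent.isUnit_one_add ⟨m, ?_⟩
  have hz : ((2 : ZMod (2 ^ m)) ^ m) = 0 := two_pow_self_eq_zero m
  rw [mul_pow, ← pow_mul, mul_comm s, pow_mul, hz, zero_pow (by omega), zero_mul]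

theorem isUnit_intCast_of_eight_dvd_sub_one {m : ℕ} {r : ℤ} (hr : 8 ∣ r - 1) :
    IsUnit (r : ZMod (2 ^ m)) := by
  obtain ⟨k, hk⟩ := hr
  rw [eq_add_of_sub_eq hk, show ((8 * k + 1 : ℤ) : ZMod (2 ^ m)) = 1 + 2 ^ 3 * k by
    push_cast; ring]
  exact isUnit_one_add_two_pow_mul (by norm_num) _

open ZMod in
/-- The stationary phase reduction of a Gauss sum modulo `2 ^ m`. -/
theorem sum_eq_sum_stationary {m n M s : ℕ} [NeZero (2 ^ m)] (hs1 : 1 ≤ s)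
    (hs2 : M ≤ 2 * s - 1) (hm : m = M + n) (χ : DirichletCharacter ℂ (2 ^ m)) (a : ZMod (2 ^ m))
    (H : ∀ y, χ (1 + 2 ^ s * y) =
      stdAddChar (-(2 ^ n * a * (2 ^ s * y - 2 ^ (2 * s - 1) * y ^ 2)) : ZMod (2 ^ m))) :
    ∑ x, χ x * stdAddChar (2 ^ n * x) =
      ∑ x, if 2 ^ (n + s) * (x - a) = 0 then χ x * stdAddChar (2 ^ n * x) else 0 := by
  have hz : (2 : ZMod (2 ^ m)) ^ n * 2 ^ (2 * s - 1) = 0 := by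
    rw [← pow_add, show n + (2 * s - 1) = m + (2 * s - 1 - M) by omega, pow_add]
    have : ((2 : ZMod (2 ^ m)) ^ m) = 0 := two_pow_self_eq_zero m
    rw [this, zero_mul]
  have hN : ((2 ^ m : ℕ) : ℂ) ≠ 0 := NeZero.ne _
  have hy : ∀ y : ZMod (2 ^ m), ∑ x, χ x * stdAddChar (2 ^ n * x) =
      ∑ x, χ x * stdAddChar (2 ^ n * x) * stdAddChar (y * (2 ^ (n + s) * (x - a))) := by
    intro y
    obtain ⟨u, hu⟩ := isUnit_one_add_two_pow_mul hs1 y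
    rw [← Equiv.sum_comp (Units.mulLeft u)]
    refine Finset.sum_congr rfl fun x _ ↦ ?_
    rw [Units.mulLeft_apply, hu, map_mul, H, mul_comm (stdAddChar _), mul_assoc,
      ← AddChar.map_add_eq_mul, mul_assoc (χ x), ← AddChar.map_add_eq_mul]
    congr 2
    simp only [pow_add]
    linear_combination a * y ^ 2 * hz
  refine mul_left_cancel₀ hN ?_
  calc ((2 ^ m : ℕ) : ℂ) * ∑ x, χ x * stdAddChar (2 ^ n * x)
      = ∑ y : ZMod (2 ^ m), ∑ x, χ x * stdAddChar (2 ^ n * x) := by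
        rw [Finset.sum_const, Finset.card_univ, ZMod.card, nsmul_eq_mul]
    _ = ∑ y : ZMod (2 ^ m), ∑ x, χ x * stdAddChar (2 ^ n * x) *
          stdAddChar (y * (2 ^ (n + s) * (x - a))) := Finset.sum_congr rfl fun y _ ↦ hy y
    _ = _ := by
        rw [Finset.sum_comm, Finset.mul_sum]
        refine Finset.sum_congr rfl fun x _ ↦ ?_
        rw [← Finset.mul_sum, AddChar.sum_mulShift _ (isPrimitive_stdAddChar _), ZMod.card]
        split_ifs <;> simp [mul_comm]

theorem sum_filter_eq_sum_range {m s t : ℕ} [NeZero (2 ^ m)] (hm : m = s + t)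
    (f : ZMod (2 ^ m) → ℂ) :
    (∑ x, if 2 ^ s * (x - 1) = 0 then f x else 0) =
      ∑ w ∈ Finset.range (2 ^ s), f (1 + 2 ^ t * w) := by
  rw [← Finset.sum_filter]
  symm
  refine Finset.sum_bij (fun w _ ↦ 1 + 2 ^ t * w) ?_ ?_ ?_ (fun _ _ ↦ rfl)
  · intro w _
    have hz : (2 : ZMod (2 ^ m)) ^ s * 2 ^ t = 0 := by
      rw [← pow_add, ← hm]
      exact two_pow_self_eq_zero m
    simp only [Finset.mem_filter, Finset.mem_univ, true_and]
    linear_combination w * hz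
  · intro w hw w' hw' h
    rw [Finset.mem_range] at hw hw'
    have h1 : ((2 ^ t * w : ℕ) : ZMod (2 ^ m)) = (2 ^ t * w' : ℕ) := by
      push_cast
      exact add_left_cancel h
    have hlt : ∀ w < 2 ^ s, 2 ^ t * w < 2 ^ m := fun w hw ↦ by
      rw [hm, pow_add, mul_comm]
      exact Nat.mul_lt_mul_of_pos_right hw (by positivity)
    have h2 := (ZMod.natCast_eq_natCast_iff' _ _ _).1 h1
    rw [Nat.mod_eq_of_lt (hlt w hw), Nat.mod_eq_of_lt (hlt w' hw')] at h2
    exact Nat.eq_of_mul_eq_mul_left (by positivity) h2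
  · intro x hx
    simp only [Finset.mem_filter, Finset.mem_univ, true_and] at hx
    have h1 : ((2 ^ s * (x - 1).val : ℕ) : ZMod (2 ^ m)) = 0 := by
      push_cast
      rw [ZMod.natCast_zmod_val, hx]
    have h2 : 2 ^ m = 2 ^ s * 2 ^ t := by rw [hm, pow_add]
    rw [ZMod.natCast_eq_zero_iff] at h1
    obtain ⟨w, hw⟩ := Nat.dvd_of_mul_dvd_mul_left (by positivity) (h2.symm.dvd.trans h1)
    refine ⟨w, ?_, ?_⟩
    · rw [Finset.mem_range]
      have := (x - 1).val_lt
      rw [hw] at this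
      exact Nat.lt_of_mul_lt_mul_left (this.trans_eq (h2.trans (mul_comm _ _)))
    · have h2 : ((x - 1).val : ZMod (2 ^ m)) = 2 ^ t * w := by rw [hw]; push_cast; rfl
      rw [← h2, ZMod.natCast_zmod_val]
      ring

open ZMod in
theorem sum_eq_mul_quadratic_sum {m n M s t : ℕ} [NeZero (2 ^ m)] (hs1 : 1 ≤ s) (ht1 : 1 ≤ t)
    (hs2 : M ≤ 2 * s - 1) (hM : M = s + t) (hm : m = M + n) (χ : DirichletCharacter ℂ (2 ^ m))
    (a : ZMod (2 ^ m)) (ha : IsUnit a)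
    (H : ∀ l y, l = s ∨ l = t → χ (1 + 2 ^ l * y) =
      stdAddChar (-(2 ^ n * a * (2 ^ l * y - 2 ^ (2 * l - 1) * y ^ 2)) : ZMod (2 ^ m))) :
    ∑ x, χ x * stdAddChar (2 ^ n * x) = χ a * stdAddChar (2 ^ n * a) *
      ∑ w ∈ Finset.range (2 ^ (n + s)), stdAddChar (2 ^ (n + 2 * t - 1) * a * w ^ 2 : ZMod (2 ^ m)) := by
  rw [sum_eq_sum_stationary hs1 hs2 hm χ a fun y ↦ H s y (Or.inl rfl)]
  obtain ⟨u, rfl⟩ := ha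
  rw [← Equiv.sum_comp (Units.mulLeft u)]
  have hiff : ∀ x : ZMod (2 ^ m), 2 ^ (n + s) * ((u : ZMod (2 ^ m)) * x - u) = 0 ↔ 2 ^ (n + s) * (x - 1) = 0 := by
    intro x
    rw [show 2 ^ (n + s) * ((u : ZMod (2 ^ m)) * x - u) = u * (2 ^ (n + s) * (x - 1)) by ring]
    exact Units.mul_right_eq_zero u
  simp only [Units.mulLeft_apply, hiff]
  rw [sum_filter_eq_sum_range (t := t) (by omega)
    (fun x : ZMod (2 ^ m) ↦ χ (u * x) * stdAddChar (2 ^ n * ((u : ZMod (2 ^ m)) * x))), Finset.mul_sum]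
  refine Finset.sum_congr rfl fun w _ ↦ ?_
  rw [map_mul, H t w (Or.inr rfl), mul_assoc, ← AddChar.map_add_eq_mul, mul_assoc (χ u),
    ← AddChar.map_add_eq_mul]
  congr 2
  rw [show n + 2 * t - 1 = n + (2 * t - 1) by omega, pow_add _ n]
  ring

theorem sum_range_mul_of_periodic (f : ℕ → ℂ) (d : ℕ) (hf : Function.Periodic f d) (K : ℕ) :
    ∑ w ∈ Finset.range (K * d), f w = K * ∑ w ∈ Finset.range d, f w := by
  induction K with
  | zero => simp
  | succ K ih =>
    rw [Nat.succ_mul, Finset.sum_range_add, ih]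
    have : ∀ x, f (K * d + x) = f x := fun x ↦ by
      rw [add_comm]
      exact hf.nat_mul K x
    simp only [this]
    push_cast
    ring

theorem omega_sq : omega ^ 2 = I := by
  rw [omega, ← Complex.exp_nat_mul,
    show ((2 : ℕ) : ℂ) * (Real.pi * I / 4) = Real.pi / 2 * I by push_cast; ring,
    Complex.exp_pi_div_two_mul_I]

theorem omega_pow_four : omega ^ 4 = -1 := by
  rw [show 4 = 2 * 2 from rfl, pow_mul, omega_sq, I_sq]

theorem omega_pow_eight : omega ^ 8 = 1 := by
  rw [show 8 = 4 * 2 from rfl, pow_mul, omega_pow_four]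
  norm_num

theorem omega_pow_add_eight_mul (b q : ℕ) : omega ^ (b + 8 * q) = omega ^ b := by
  rw [pow_add, pow_mul, omega_pow_eight, one_pow, mul_one]

theorem sqrt_two_sq : (Real.sqrt 2 : ℂ) ^ 2 = 2 := by
  rw [← ofReal_pow, Real.sq_sqrt (by norm_num)]
  norm_num

theorem sqrt_two_mul_omega : (Real.sqrt 2 : ℂ) * omega = 1 + omega ^ 2 := by
  have h : omega = (Real.sqrt 2 : ℂ) / 2 * (1 + I) := by
    rw [omega, show (Real.pi * I / 4 : ℂ) = ((Real.pi / 4 : ℝ) : ℂ) * I by push_cast; ring,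
      exp_mul_I, ← ofReal_cos, ← ofReal_sin, Real.cos_pi_div_four, Real.sin_pi_div_four]
    push_cast
    ring
  rw [omega_sq, h]
  linear_combination (1 + I) / 2 * sqrt_two_sq

theorem neg_one_pow_eq_χ₈ {c : ℕ} (hc : Odd c) :
    (-1 : ℂ) ^ ((c ^ 2 - 1) / 8) = (ZMod.χ₈ c : ℤ) := by
  obtain ⟨b, q, rfl, hb⟩ : ∃ b q, c = 8 * q + b ∧ (b = 1 ∨ b = 3 ∨ b = 5 ∨ b = 7) :=
    ⟨c % 8, c / 8, by omega, by have := Nat.odd_iff.1 hc; omega⟩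
  have h : ((8 * q + b) ^ 2 - 1) / 8 = 2 * (4 * q ^ 2 + q * b) + (b ^ 2 - 1) / 8 := by
    rw [show (8 * q + b) ^ 2 = 8 * (2 * (4 * q ^ 2 + q * b)) + b ^ 2 by ring]
    rcases hb with rfl | rfl | rfl | rfl <;> omega
  rw [h, pow_add, pow_mul, neg_one_sq, one_pow, one_mul, ZMod.χ₈_nat_eq_if_mod_eight]
  rcases hb with rfl | rfl | rfl | rfl <;> norm_num [Nat.add_mod, Nat.mul_mod]

theorem one_add_omega_pow_two_mul {c : ℕ} (hc : Odd c) :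
    1 + omega ^ (2 * c) = (Real.sqrt 2 : ℂ) * ((-1) ^ ((c ^ 2 - 1) / 8) * omega ^ c) := by
  rw [neg_one_pow_eq_χ₈ hc, ZMod.χ₈_nat_eq_if_mod_eight]
  obtain ⟨b, q, rfl, hb⟩ : ∃ b q, c = b + 8 * q ∧ (b = 1 ∨ b = 3 ∨ b = 5 ∨ b = 7) :=
    ⟨c % 8, c / 8, by omega, by have := Nat.odd_iff.1 hc; omega⟩
  rw [omega_pow_add_eight_mul, show 2 * (b + 8 * q) = 2 * b + 8 * (2 * q) by ring,
    omega_pow_add_eight_mul]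
  have h1 := sqrt_two_mul_omega
  have h4 := omega_pow_four
  rcases hb with rfl | rfl | rfl | rfl <;> norm_num [Nat.add_mod, Nat.mul_mod]
  · linear_combination -h1
  · linear_combination omega ^ 2 * h1 + (1 + omega ^ 2) * h4
  · linear_combination omega ^ 4 * h1 + (1 + omega ^ 6) * h4
  · linear_combination -omega ^ 6 * h1 + (1 - omega ^ 4) * (1 - omega ^ 6) * h4

open ZMod in
theorem stdAddChar_two_pow_mul {m : ℕ} [NeZero (2 ^ m)] (hm : 3 ≤ m) (j : ℕ) :
    stdAddChar (2 ^ (m - 3) * j : ZMod (2 ^ m)) = omega ^ j := by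
  have h := stdAddChar_coe (N := 2 ^ m) (2 ^ (m - 3) * j)
  push_cast at h
  rw [h, omega, ← Complex.exp_nat_mul]
  congr 1
  obtain ⟨t, rfl⟩ := Nat.exists_eq_add_of_le hm
  rw [Nat.add_sub_cancel_left, pow_add]
  field_simp
  norm_num
  ring

open ZMod in
/-- Explicit evaluation of the Gauss sum modulo `2 ^ (M + n)` of a character of conductor
`2 ^ M`. -/
theorem sum_mul_stdAddChar_eq {m n M : ℕ} [NeZero (2 ^ m)] (hm : m = M + n) (hM : 5 ≤ M)
    (χ : DirichletCharacter ℂ (2 ^ m)) {c : ℕ} (hc : Odd c) (r : ℤ) (hr8 : 8 ∣ r - 1)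
    (h5 : χ 5 = stdAddChar (2 ^ n * 4 * c : ZMod (2 ^ m)))
    (hr : ∀ (s M L : ℕ) (y : ℤ), 2 ≤ s → s ≤ m → M ≤ m → M ≤ 3 * s →
      2 ^ m ∣ 5 ^ L - (1 + 2 ^ s * y) →
      2 ^ M ∣ 4 * L + r * (2 ^ s * y - 2 ^ (2 * s - 1) * y ^ 2)) :
    ∑ x, χ x * stdAddChar (2 ^ n * x) =
      2 ^ n * (Real.sqrt 2 : ℂ) ^ M * (χ (r * c) * stdAddChar (2 ^ n * (r * c) : ZMod (2 ^ m))) *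
        ((-1) ^ ((c ^ 2 - 1) / 8 * M) * omega ^ c) := by
  have hz : (2 : ZMod (2 ^ m)) ^ (m - 3) * 8 = 0 := by
    rw [show (8 : ZMod (2 ^ m)) = 2 ^ 3 by norm_num, ← pow_add, Nat.sub_add_cancel (by omega)]
    exact two_pow_self_eq_zero m
  have hrz : (2 : ZMod (2 ^ m)) ^ (m - 3) * r = 2 ^ (m - 3) := by
    obtain ⟨k, hk⟩ := hr8
    rw [eq_add_of_sub_eq hk]
    push_cast
    linear_combination k * hz
  have hu : IsUnit ((r : ZMod (2 ^ m)) * c) := (isUnit_intCast_of_eight_dvd_sub_one hr8).mul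
    ((ZMod.isUnit_iff_coprime c (2 ^ m)).2 (hc.coprime_two_right.pow_right m))
  have H : ∀ l (y : ZMod (2 ^ m)), 2 ≤ l → l ≤ m → M ≤ 3 * l → χ (1 + 2 ^ l * y) = stdAddChar
      (-(2 ^ n * (r * c) * (2 ^ l * y - 2 ^ (2 * l - 1) * y ^ 2)) : ZMod (2 ^ m)) :=
    fun l y h1 h2 h3 ↦ by
      have := apply_one_add_of_discrete_log hm χ c r (by exact_mod_cast h5) hr h1 h2 h3 y
      exact_mod_cast this
  have h8 := omega_pow_eight
  rcases Nat.even_or_odd' M with ⟨h, rfl | rfl⟩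
  · have key := sum_eq_mul_quadratic_sum (s := h + 1) (t := h - 1) (by omega) (by omega)
      (by omega) (by omega) hm χ (r * c) hu
      (fun l y hl ↦ H l y (by omega) (by omega) (by omega))
    have hterm : ∀ w : ℕ, stdAddChar (2 ^ (n + 2 * (h - 1) - 1) * (r * c) * w ^ 2 : ZMod (2 ^ m)) =
        omega ^ (c * w ^ 2) := fun w ↦ by
      rw [← stdAddChar_two_pow_mul (m := m) (by omega), show n + 2 * (h - 1) - 1 = m - 3 by omega]
      congr 1
      push_cast
      linear_combination c * w ^ 2 * hrz
    have hper : Function.Periodic (fun w : ℕ ↦ omega ^ (c * w ^ 2)) 8 := fun w ↦ by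
      beta_reduce
      rw [show c * (w + 8) ^ 2 = c * w ^ 2 + 8 * (c * (2 * w + 8)) by ring,
        omega_pow_add_eight_mul]
    rw [key]
    simp only [hterm]
    rw [show 2 ^ (n + (h + 1)) = 2 ^ (n + (h - 2)) * 8 by
      rw [show n + (h + 1) = n + (h - 2) + 3 by omega, pow_add]; norm_num,
      sum_range_mul_of_periodic _ _ hper]
    have hQ : ∑ w ∈ Finset.range 8, omega ^ (c * w ^ 2) = 4 * omega ^ c := by
      have h1 : ∀ k, omega ^ (c * (8 * k + 1)) = omega ^ c := fun k ↦ by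
        rw [show c * (8 * k + 1) = c + 8 * (c * k) by ring, omega_pow_add_eight_mul]
      have h4 : ∀ k, omega ^ (c * (8 * k + 4)) = -1 := fun k ↦ by
        rw [show c * (8 * k + 4) = 4 * c + 8 * (c * k) by ring, omega_pow_add_eight_mul, pow_mul,
          omega_pow_four, hc.neg_one_pow]
      have h0 : ∀ k, omega ^ (c * (8 * k)) = 1 := fun k ↦ by
        rw [show c * (8 * k) = 0 + 8 * (c * k) by ring, omega_pow_add_eight_mul, pow_zero]
      have e1 := h1 0; have e3 := h1 1; have e5 := h1 3; have e7 := h1 6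
      have e2 := h4 0; have e6 := h4 4; have e0 := h0 0; have e4 := h0 2
      norm_num at e1 e2 e3 e4 e5 e6 e7 e0
      norm_num [Finset.sum_range_succ, e2, e3, e4, e5, e6, e7]
      ring
    have hs : (-1 : ℂ) ^ ((c ^ 2 - 1) / 8 * (2 * h)) = 1 := by
      rw [mul_left_comm, pow_mul, neg_one_sq, one_pow]
    rw [hQ, hs, pow_mul (Real.sqrt 2 : ℂ), sqrt_two_sq]
    obtain ⟨g, rfl⟩ : ∃ g, h = g + 2 := ⟨h - 2, by omega⟩
    rw [Nat.add_sub_cancel]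
    push_cast
    ring
  · have key := sum_eq_mul_quadratic_sum (s := h + 1) (t := h) (by omega) (by omega)
      (by omega) (by omega) hm χ (r * c) hu
      (fun l y hl ↦ H l y (by omega) (by omega) (by omega))
    have hterm : ∀ w : ℕ, stdAddChar (2 ^ (n + 2 * h - 1) * (r * c) * w ^ 2 : ZMod (2 ^ m)) =
        omega ^ (2 * c * w ^ 2) := fun w ↦ by
      rw [← stdAddChar_two_pow_mul (m := m) (by omega),
        show n + 2 * h - 1 = (m - 3) + 1 by omega]
      congr 1
      push_cast
      linear_combination 2 * c * w ^ 2 * hrz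
    have hper : Function.Periodic (fun w : ℕ ↦ omega ^ (2 * c * w ^ 2)) 4 := fun w ↦ by
      beta_reduce
      rw [show 2 * c * (w + 4) ^ 2 = 2 * c * w ^ 2 + 8 * (c * (2 * w + 4)) by ring,
        omega_pow_add_eight_mul]
    rw [key]
    simp only [hterm]
    rw [show 2 ^ (n + (h + 1)) = 2 ^ (n + (h - 1)) * 4 by
      rw [show n + (h + 1) = n + (h - 1) + 2 by omega, pow_add]; norm_num,
      sum_range_mul_of_periodic _ _ hper]
    have hQ : ∑ w ∈ Finset.range 4, omega ^ (2 * c * w ^ 2) = 2 * (1 + omega ^ (2 * c)) := by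
      have e2 : omega ^ (2 * c * 4) = 1 := by
        rw [show 2 * c * 4 = 0 + 8 * c by ring, omega_pow_add_eight_mul, pow_zero]
      have e3 : omega ^ (2 * c * 9) = omega ^ (2 * c) := by
        rw [show 2 * c * 9 = 2 * c + 8 * (2 * c) by ring, omega_pow_add_eight_mul]
      norm_num [Finset.sum_range_succ, e2, e3]
      ring
    have hs : (-1 : ℂ) ^ ((c ^ 2 - 1) / 8 * (2 * h + 1)) = (-1) ^ ((c ^ 2 - 1) / 8) := by
      rw [show (c ^ 2 - 1) / 8 * (2 * h + 1) = 2 * ((c ^ 2 - 1) / 8 * h) + (c ^ 2 - 1) / 8 by ring,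
        pow_add, pow_mul, neg_one_sq, one_pow, one_mul]
    rw [hQ, hs, one_add_omega_pow_two_mul hc, pow_succ (Real.sqrt 2 : ℂ), pow_mul (Real.sqrt 2 : ℂ),
      sqrt_two_sq]
    obtain ⟨g, rfl⟩ : ∃ g, h = g + 1 := ⟨h - 1, by omega⟩
    rw [Nat.add_sub_cancel]
    push_cast
    ring

theorem MulChar.prod_apply_of_isUnit {R R' ι : Type*} [CommMonoid R] [CommMonoidWithZero R']
    (s : Finset ι) (χ : ι → MulChar R R') {a : R} (ha : IsUnit a) :
    (∏ i ∈ s, χ i) a = ∏ i ∈ s, χ i a := by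
  classical
  induction s using Finset.induction_on with
  | empty => simpa using MulChar.one_apply ha
  | insert i s hi ih => rw [Finset.prod_insert hi, Finset.prod_insert hi, MulChar.mul_apply, ih]

theorem MulChar.prod_apply_of_nonempty {R R' ι : Type*} [CommMonoid R] [CommMonoidWithZero R']
    {s : Finset ι} (hs : s.Nonempty) (χ : ι → MulChar R R') (a : R) :
    (∏ i ∈ s, χ i) a = ∏ i ∈ s, χ i a := by
  by_cases ha : IsUnit a
  · exact MulChar.prod_apply_of_isUnit s χ ha
  · obtain ⟨i, hi⟩ := hs
    rw [MulChar.map_nonunit _ ha, Finset.prod_eq_zero hi (MulChar.map_nonunit (χ i) ha)]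

theorem AddChar.map_finsetSum {A R ι : Type*} [AddCommMonoid A] [CommMonoid R] (ψ : AddChar A R)
    (s : Finset ι) (f : ι → A) : ψ (∑ i ∈ s, f i) = ∏ i ∈ s, ψ (f i) := by
  classical
  induction s using Finset.induction_on with
  | empty => simp
  | insert i s hi ih => rw [Finset.sum_insert hi, Finset.prod_insert hi, AddChar.map_add_eq_mul, ih]

open ZMod in
theorem mul_Jsum_eq_prod_gaussSum_mul_sum {q k : ℕ} [NeZero q] (hk : k ≠ 0)
    (χ : Fin k → DirichletCharacter ℂ q)
    (hχ : ∀ i, (χ i).IsPrimitive) (B : ZMod q) :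
    (q : ℂ) * Jsum χ B = (∏ i, gaussSum (χ i) stdAddChar) *
      ∑ t, (∏ i, χ i)⁻¹ t * stdAddChar (-(B * t)) := by
  have h (t : ZMod q) : ∑ x : Fin k → ZMod q, (∏ i, χ i (x i)) * stdAddChar (t * ((∑ i, x i) - B)) =
      (∏ i, gaussSum (χ i) stdAddChar) * ((∏ i, χ i)⁻¹ t * stdAddChar (-(B * t))) := by
    calc _ = (∑ x : Fin k → ZMod q, ∏ i, χ i (x i) * stdAddChar (t * x i)) *
          stdAddChar (-(B * t)) := by
          rw [Finset.sum_mul]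
          refine Finset.sum_congr rfl fun x _ ↦ ?_
          rw [Finset.prod_mul_distrib, mul_assoc, ← AddChar.map_finsetSum,
            ← AddChar.map_add_eq_mul, ← Finset.mul_sum]
          congr 2
          ring
      _ = (∏ i, gaussSum (χ i) (AddChar.mulShift stdAddChar t)) * stdAddChar (-(B * t)) := by
          simp only [gaussSum, AddChar.mulShift_apply]
          rw [Fintype.prod_sum]
      _ = _ := by
          simp_rw [gaussSum_mulShift_of_isPrimitive _ (hχ _)]
          have : NeZero k := ⟨hk⟩
          rw [Finset.prod_mul_distrib, ← Finset.prod_inv_distrib,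
            MulChar.prod_apply_of_nonempty Finset.univ_nonempty]
          ring
  rw [Finset.mul_sum, ← Finset.sum_congr rfl fun t _ ↦ h t, Finset.sum_comm, Jsum, Finset.mul_sum]
  refine Finset.sum_congr rfl fun x _ ↦ ?_
  rw [← Finset.mul_sum, AddChar.sum_mulShift _ (isPrimitive_stdAddChar _), ZMod.card]
  simp only [sub_eq_zero]
  split_ifs <;> simp [mul_comm]

theorem MulChar.star_apply_eq_inv {R : Type*} [CommRing R] [Finite Rˣ] (χ : MulChar R ℂ) (a : R) :
    star (χ a) = (χ a)⁻¹ := by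
  rw [MulChar.star_apply', MulChar.inv_apply_eq_inv']

theorem AddChar.star_apply_eq_inv {G : Type*} [AddCommGroup G] [Finite G] (ψ : AddChar G ℂ)
    (x : G) : star (ψ x) = (ψ x)⁻¹ := by
  rw [← AddChar.map_neg_eq_inv, AddChar.map_neg_eq_conj]
  rfl

open ZMod in
theorem sum_inv_mul_stdAddChar_neg {q : ℕ} [NeZero q] (χ : DirichletCharacter ℂ q) (B : ZMod q) :
    ∑ t, χ⁻¹ t * stdAddChar (-(B * t)) = star (∑ t, χ t * stdAddChar (B * t)) := by
  rw [star_sum]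
  refine Finset.sum_congr rfl fun t _ ↦ ?_
  rw [star_mul', MulChar.star_apply', AddChar.map_neg_eq_conj]
  rfl

theorem star_omega : star omega = omega⁻¹ := by
  have h := stdAddChar_two_pow_mul (m := 3) le_rfl 1
  rw [pow_one] at h
  rw [← h, AddChar.star_apply_eq_inv]

theorem prod_neg_one_pow_sq_sub_one_div_eight {ι : Type*} (s : Finset ι) (c : ι → ℕ)
    (hc : ∀ i, Odd (c i)) (m : ℕ) :
    ∏ i ∈ s, (-1 : ℂ) ^ ((c i ^ 2 - 1) / 8 * m) = (-1) ^ (((∏ i ∈ s, c i) ^ 2 - 1) / 8 * m) := by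
  have h : Odd (∏ i ∈ s, c i) := Finset.prod_induction _ Odd (fun _ _ ↦ Odd.mul) odd_one
    fun i _ ↦ hc i
  simp only [pow_mul, Finset.prod_pow]
  rw [neg_one_pow_eq_χ₈ h, Finset.prod_congr rfl fun i _ ↦ neg_one_pow_eq_χ₈ (hc i)]
  push_cast
  rw [map_prod]
  push_cast
  rfl

theorem stmt2 {m n k : ℕ} [NeZero (2 ^ m)] (hk : 2 ≤ k) (hm : n + 5 ≤ m)
    (χ : Fin k → DirichletCharacter ℂ (2 ^ m))
    -- the c_i with χ_i(5) = e(c_i/2^(m-2)), 1 ≤ c_i ≤ 2^(m-2)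
    (c : Fin k → ℕ) (hcrange : ∀ i, 1 ≤ c i ∧ c i ≤ 2 ^ (m - 2))
    (hχ5 : ∀ i, χ i ((5 : ℕ) : ZMod (2 ^ m)) =
      Complex.exp (2 * Real.pi * Complex.I * (c i) / (2 ^ (m - 2))))
    -- all χ_i primitive mod 2^m, i.e. all c_i odd
    (hprim : ∀ i, (χ i).IsPrimitive) (hcodd : ∀ i, Odd (c i))
    -- χ₁⋯χ_k induced by a primitive character mod 2^(m-n);
    -- in particular 2^n exactly divides c₁+⋯+c_k
    (hcond : (∏ i, χ i).conductor = 2 ^ (m - n))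
    (v : ℕ) (hv : (∑ i, c i) = 2 ^ n * v) (hvodd : Odd v) :
    Jsum χ ((2 ^ n : ℕ) : ZMod (2 ^ m)) =
      (Real.sqrt 2 : ℂ) ^ (m * (k - 1) + n) *
        (∏ i, χ i ((c i : ZMod (2 ^ m)))) *
        ((∏ i, χ i) ((v : ZMod (2 ^ m))))⁻¹ *
        -- δ = (2/v)^(m-n) (2/(c₁⋯c_k))^m ω^((2^n-1)v), where (2/c) = (-1)^((c²-1)/8)
        ((-1 : ℂ) ^ ((v ^ 2 - 1) / 8 * (m - n)) *
         (-1 : ℂ) ^ (((∏ i, c i) ^ 2 - 1) / 8 * m) *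
         omega ^ ((2 ^ n - 1) * v)) := by
  obtain ⟨M, rfl⟩ : ∃ M, m = M + n := ⟨m - n, by omega⟩
  obtain ⟨r, hr8, hr⟩ := exists_discrete_log_approx (M + n)
  have h5 : ∀ i, χ i 5 = ZMod.stdAddChar (4 * c i : ZMod (2 ^ (M + n))) := fun i ↦ by
    have h := ZMod.stdAddChar_coe (N := 2 ^ (M + n)) (4 * c i)
    have h' := hχ5 i
    push_cast at h h'
    rw [h, h']
    congr 1
    obtain ⟨t, ht⟩ : ∃ t, M + n = t + 2 := ⟨M + n - 2, by omega⟩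
    rw [ht, Nat.add_sub_cancel, pow_add]
    field_simp
    norm_num
    ring
  have hu5 : IsUnit (5 : ZMod (2 ^ (M + n))) := by
    exact_mod_cast (ZMod.isUnit_iff_coprime 5 (2 ^ (M + n))).2
      (Nat.Coprime.pow_right _ (by norm_num))
  have hvz : ∑ i, (c i : ZMod (2 ^ (M + n))) = 2 ^ n * v := by exact_mod_cast congrArg Nat.cast hv
  have hG : ∀ i, gaussSum (χ i) ZMod.stdAddChar = (Real.sqrt 2 : ℂ) ^ (M + n) *
      (χ i (r * c i) * ZMod.stdAddChar (r * c i : ZMod (2 ^ (M + n)))) *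
      ((-1) ^ ((c i ^ 2 - 1) / 8 * (M + n)) * omega ^ c i) := fun i ↦ by
    have := sum_mul_stdAddChar_eq (m := M + n) (n := 0) (M := M + n) rfl (by omega) (χ i)
      (hcodd i) r hr8 (by rw [h5]; simp) hr
    simpa [gaussSum] using this
  have hprod : (∏ i, χ i) 5 = ZMod.stdAddChar (2 ^ n * 4 * v : ZMod (2 ^ (M + n))) := by
    rw [MulChar.prod_apply_of_isUnit _ _ hu5, Finset.prod_congr rfl fun i _ ↦ h5 i,
      ← AddChar.map_finsetSum, ← Finset.mul_sum, hvz]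
    congr 1
    ring
  have hK := sum_mul_stdAddChar_eq (m := M + n) rfl (by omega) (∏ i, χ i) hvodd r hr8 hprod hr
  have hJ := mul_Jsum_eq_prod_gaussSum_mul_sum (by omega) χ hprim ((2 ^ n : ℕ) : ZMod (2 ^ (M + n)))
  rw [sum_inv_mul_stdAddChar_neg] at hJ
  push_cast at hJ ⊢
  rw [hK, Finset.prod_congr rfl fun i _ ↦ hG i] at hJ
  have hru : IsUnit (r : ZMod (2 ^ (M + n))) := isUnit_intCast_of_eight_dvd_sub_one hr8
  have hr0 : (∏ i, χ i) (r : ZMod (2 ^ (M + n))) ≠ 0 := (hru.map (∏ i, χ i)).ne_zero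
  have hrprod : ∏ i, χ i (r : ZMod (2 ^ (M + n))) = (∏ i, χ i) (r : ZMod (2 ^ (M + n))) :=
    (MulChar.prod_apply_of_isUnit _ _ hru).symm
  have hE : ∏ i, ZMod.stdAddChar (r * c i : ZMod (2 ^ (M + n))) =
      ZMod.stdAddChar (2 ^ n * (r * v) : ZMod (2 ^ (M + n))) := by
    rw [← AddChar.map_finsetSum, ← Finset.mul_sum, hvz]
    congr 1
    ring
  have hE0 : ZMod.stdAddChar (2 ^ n * (r * v) : ZMod (2 ^ (M + n))) ≠ 0 :=
    (AddChar.val_isUnit _ _).ne_zero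
  have hω : omega ^ (2 ^ n * v) = omega ^ ((2 ^ n - 1) * v) * omega ^ v := by
    rw [← pow_add, ← Nat.succ_mul, Nat.succ_eq_add_one, Nat.sub_add_cancel Nat.one_le_two_pow]
  have hω0 : omega ≠ 0 := Complex.exp_ne_zero _
  have h2 : (2 : ℂ) ^ (M + n) = (Real.sqrt 2 : ℂ) ^ (2 * (M + n)) := by
    rw [pow_mul, sqrt_two_sq]
  have h2n : (2 : ℂ) ^ n = (Real.sqrt 2 : ℂ) ^ (2 * n) := by
    rw [pow_mul, sqrt_two_sq]
  have hstar : star (Real.sqrt 2 : ℂ) = Real.sqrt 2 := Complex.conj_ofReal _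
  simp only [Finset.prod_mul_distrib, Finset.prod_const, Finset.card_univ, Fintype.card_fin,
    map_mul, hrprod, hE, prod_neg_one_pow_sq_sub_one_div_eight _ _ hcodd, Finset.prod_pow_eq_pow_sum,
    hv, hω, star_mul', star_pow, star_neg, star_one, MulChar.star_apply_eq_inv,
    AddChar.star_apply_eq_inv, star_omega, star_ofNat, hstar] at hJ
  refine mul_left_cancel₀ (pow_ne_zero (M + n) two_ne_zero) (hJ.trans ?_)
  obtain ⟨l, rfl⟩ := Nat.exists_eq_add_of_le hk
  rw [h2, h2n, Nat.add_sub_cancel, show 2 + l - 1 = l + 1 by omega, inv_pow]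
  field_simp
  ring
end

section
/- Let p be an odd prime, k ≥ 2, and m ≥ 2 even. Let χ1,…,χk be primitive characters mod p^m such that χ1⋯χk is also primitive mod p^m, and set v := c1+⋯+ck (so p ∤ v). Then J(χ1,…,χk,p^m) = p^{m(k−1)/2} · χ1(c1)⋯χk(ck) · (χ1⋯χk(v))^{−1}. -/
open Complex

namespace MulChar

variable {R : Type*} [CommRing R]

lemma isUnit_one_add_mul {t : R} (ht : t * t = 0) (s : R) : IsUnit (1 + t * s) :=
  IsUnit.of_mul_eq_one (1 - t * s) (by linear_combination (-s * s) * ht)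

/-- If `t ^ 2 = 0`, a multiplicative character `ω` yields the additive character
`s ↦ ω (1 + t * s)`. -/
noncomputable def oneAddMul (ω : MulChar R ℂ) {t : R} (ht : t * t = 0) : AddChar R ℂ where
  toFun s := ω (1 + t * s)
  map_zero_eq_one' := by simp
  map_add_eq_mul' x y := by
    rw [← map_mul]
    congr 1
    linear_combination (-x * y) * ht

lemma oneAddMul_apply (ω : MulChar R ℂ) {t : R} (ht : t * t = 0) (s : R) :
    oneAddMul ω ht s = ω (1 + t * s) := rfl

lemma pow_one_add_mul (ω : MulChar R ℂ) {t : R} (ht : t * t = 0) (c : ℕ) (s : R) :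
    (ω ^ c) (1 + t * s) = oneAddMul ω ht (c * s) := by
  induction c with
  | zero => simp [one_apply (isUnit_one_add_mul ht s)]
  | succ c ih =>
    rw [pow_succ, mul_apply, ih, ← oneAddMul_apply ω ht, ← AddChar.map_add_eq_mul]
    congr 1
    push_cast
    ring

variable {ι : Type*} [Fintype ι]

lemma prod_pow_add_mul (ω : MulChar R ℂ) {t : R} (ht : t * t = 0) (c : ι → ℕ) (x : ι → Rˣ)
    (y : ι → R) :
    ∏ i, (ω ^ c i) (x i + t * y i) =
      (∏ i, (ω ^ c i) (x i)) * oneAddMul ω ht (∑ i, c i * (↑(x i)⁻¹ * y i)) := by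
  have hsum (s : Finset ι) (f : ι → R) :
      oneAddMul ω ht (∑ i ∈ s, f i) = ∏ i ∈ s, oneAddMul ω ht (f i) := by
    induction s using Finset.cons_induction with
    | empty => simp
    | cons a s h ih => rw [Finset.sum_cons, Finset.prod_cons, AddChar.map_add_eq_mul, ih]
  rw [hsum, ← Finset.prod_mul_distrib]
  refine Finset.prod_congr rfl fun i _ ↦ ?_
  rw [← pow_one_add_mul, ← map_mul]
  congr 1
  linear_combination (-t * y i) * (x i).mul_inv

/-- The contribution of a point of `∑ i, x i = 1` away from the critical locus, averaged over its
translates by multiples of `t`, vanishes. -/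
lemma sum_prod_pow_add_mul_eq_zero [Fintype R] [DecidableEq ι] (ω : MulChar R ℂ) {t : R}
    (ht : t * t = 0) (hω : ∀ s, ω (1 + t * s) = 1 → t * s = 0) (c : ι → ℕ) (v : Rˣ)
    (hv : (v : R) = ∑ i, (c i : R))
    (i₀ : ι) (x : ι → R) (hx : ∑ i, x i = 1) (hxc : ¬ ∀ i, t * (v * x i) = t * c i) :
    ∑ u : ι → R, ∏ i, (ω ^ c i)
      (x i + t * (u i - Pi.single (M := fun _ ↦ R) i₀ (∑ j, u j) i)) = 0 := by
  by_cases hxu : ∀ i, IsUnit (x i)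
  · choose x' hx' using hxu
    obtain rfl : (fun i ↦ (x' i : R)) = x := funext hx'
    simp_rw [prod_pow_add_mul ω ht c x']
    rw [← Finset.mul_sum]
    let b : ι → R := fun i ↦ c i * ↑(x' i)⁻¹
    let g : (ι → R) →+ R :=
      { toFun := fun u ↦ ∑ i, (b i - b i₀) * u i
        map_zero' := by simp
        map_add' := fun u w ↦ by simp [mul_add, Finset.sum_add_distrib] }
    have hg (u : ι → R) :
        ∑ i, (c i : R) * (↑(x' i)⁻¹ * (u i - Pi.single (M := fun _ ↦ R) i₀ (∑ j, u j) i)) = g u := by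
      have h1 (i : ι) : (c i : R) * (↑(x' i)⁻¹ *
          (u i - Pi.single (M := fun _ ↦ R) i₀ (∑ j, u j) i)) =
          b i * u i - (if i = i₀ then b i * ∑ j, u j else 0) := by
        by_cases h : i = i₀
        · subst h; simp [b]; ring
        · simp [b, h]; ring
      simp only [h1, Finset.sum_sub_distrib, Finset.sum_ite_eq', Finset.mem_univ, if_true,
        Finset.mul_sum]
      simp [g, sub_mul, Finset.sum_sub_distrib]
    simp_rw [hg]
    refine mul_eq_zero_of_right _ ?_
    change ∑ u, (oneAddMul ω ht).compAddMonoidHom g u = 0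
    rw [AddChar.sum_eq_zero_iff_ne_zero]
    intro h0
    apply hxc
    have hb (i : ι) : t * (b i - b i₀) = 0 := by
      apply hω
      have := DFunLike.congr_fun h0 (Pi.single i 1)
      simpa [g, oneAddMul_apply, Pi.single_apply] using this
    have hc (i : ι) : t * (c i : R) = t * b i₀ * x' i := by
      have h2 := hb i
      simp only [b] at h2 ⊢
      linear_combination (x' i : R) * h2 - t * c i * (x' i).inv_mul
    have hv' : t * v = t * b i₀ := by
      rw [hv, Finset.mul_sum, Finset.sum_congr rfl fun i _ ↦ hc i, ← Finset.mul_sum, hx, mul_one]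
    intro i
    rw [hc, ← hv', mul_assoc]
  · push Not at hxu
    obtain ⟨i, hi⟩ := hxu
    refine Finset.sum_eq_zero fun u _ ↦ Finset.prod_eq_zero (Finset.mem_univ i) (map_nonunit _ ?_)
    contrapose! hi
    set w := u i - Pi.single (M := fun _ ↦ R) i₀ (∑ j, u j) i
    obtain ⟨y, hy⟩ := hi
    refine IsUnit.of_mul_eq_one (↑y⁻¹ * (1 + t * (w * ↑y⁻¹))) ?_
    have : x i = y - t * w := by rw [hy]; ring
    rw [this]
    linear_combination (1 + t * (w * ↑y⁻¹)) * y.mul_inv - (w * w * ↑y⁻¹ * ↑y⁻¹) * ht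

/-- The number of solutions of `∑ i, x i = 1` congruent to a given one modulo the annihilator
of `t`. -/
lemma card_sum_eq_one_and_mul_eq [Fintype R] [DecidableEq R] (n : ℕ) (t : R) (z : Fin (n + 1) → R)
    (hz : ∑ i, z i = 1) :
    (Finset.univ.filter fun x : Fin (n + 1) → R ↦
      (∑ i, x i = 1) ∧ ∀ i, t * x i = t * z i).card = Nat.card {d : R // t * d = 0} ^ n := by
  classical
  rw [← Fintype.card_subtype, ← Nat.card_eq_fintype_card]
  have e : {x : Fin (n + 1) → R // (∑ i, x i = 1) ∧ ∀ i, t * x i = t * z i} ≃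
      (Fin n → {d : R // t * d = 0}) :=
    { toFun := fun x i ↦ ⟨x.1 i.succ - z i.succ, by rw [mul_sub, x.2.2, sub_self]⟩
      invFun := fun d ↦ ⟨z + Fin.cons (-∑ i, (d i : R)) fun i ↦ (d i : R), by
        simp [Fin.sum_univ_succ, Finset.sum_add_distrib] at hz ⊢
        linear_combination hz, by
        intro i
        refine Fin.cases ?_ (fun i ↦ ?_) i
        · simp [mul_add, Finset.mul_sum, (d _).2]
        · simp [mul_add, (d _).2]⟩
      left_inv := by
        rintro ⟨x, hx, hx'⟩
        ext i
        refine Fin.cases ?_ (fun i ↦ ?_) i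
        · simp [Fin.sum_univ_succ] at hz hx ⊢
          linear_combination hz - hx
        · simp
      right_inv := by
        intro d
        ext i
        simp }
  rw [Nat.card_congr e, Nat.card_fun, Nat.card_eq_fintype_card (α := Fin n), Fintype.card_fin]

/-- Evaluation of a Jacobi sum by a `t ^ 2 = 0` version of the method of stationary phase. -/
theorem sum_prod_pow_eq [Fintype R] [DecidableEq R] {n : ℕ} (ω : MulChar R ℂ) {t : R}
    (ht : t * t = 0) (hann : ∀ d, t * d = 0 → ∃ w, d = t * w)
    (hω : ∀ s, ω (1 + t * s) = 1 → t * s = 0) (c : Fin (n + 1) → ℕ) (hc : ∀ i, IsUnit (c i : R))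
    (hv : IsUnit (∑ i, (c i : R))) :
    (∑ x : Fin (n + 1) → R, if ∑ i, x i = 1 then ∏ i, (ω ^ c i) (x i) else 0) =
      (Nat.card {d : R // t * d = 0} : ℂ) ^ n * (∏ i, (ω ^ c i) (c i : R)) *
        ((∏ i, ω ^ c i) (∑ i, (c i : R)))⁻¹ := by
  obtain ⟨v, hv⟩ := hv
  choose c' hc' using hc
  let z : Fin (n + 1) → Rˣ := fun i ↦ v⁻¹ * c' i
  have hz : ∑ i, (z i : R) = 1 := by
    simp [z, hc', ← Finset.mul_sum, ← hv]
  have hval : ∏ i, (ω ^ c i) (z i) =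
      (∏ i, (ω ^ c i) (c i : R)) * ((∏ i, ω ^ c i) (∑ i, (c i : R)))⁻¹ := by
    have hprod (s : Finset (Fin (n + 1))) :
        (∏ i ∈ s, ω ^ c i) (v : R) = ∏ i ∈ s, (ω ^ c i) (v : R) := by
      induction s using Finset.cons_induction with
      | empty => simp
      | cons a s h ih => simp only [Finset.prod_cons, mul_apply, ih]
    rw [← hv, hprod, ← Finset.prod_inv_distrib, ← Finset.prod_mul_distrib]
    refine Finset.prod_congr rfl fun i _ ↦ ?_
    rw [eq_mul_inv_iff_mul_eq₀ (v.isUnit.map _).ne_zero, ← map_mul]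
    simp [z, hc', mul_right_comm]
  rw [mul_assoc, ← hval, ← Finset.sum_filter]
  have hcrit (x : Fin (n + 1) → R) (i) : t * (v * x i) = t * c i ↔ t * x i = t * z i := by
    rw [← v.isUnit.mul_right_inj (b := t * x i)]
    simp [z, hc', mul_left_comm]
  rw [← Finset.sum_filter_add_sum_filter_not _ fun x ↦ ∀ i, t * x i = t * z i]
  have hnot : ∑ x : Fin (n + 1) → R with ∑ i, x i = 1 ∧ ¬ ∀ i, t * x i = t * z i,
      ∏ i, (ω ^ c i) (x i) = 0 := by
    let y : (Fin (n + 1) → R) → Fin (n + 1) → R := fun u i ↦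
      t * (u i - Pi.single (M := fun _ ↦ R) 0 (∑ j, u j) i)
    have hshift (u : Fin (n + 1) → R) :
        ∑ x : Fin (n + 1) → R with ∑ i, x i = 1 ∧ ¬ ∀ i, t * x i = t * z i,
          ∏ i, (ω ^ c i) (x i) =
        ∑ x : Fin (n + 1) → R with ∑ i, x i = 1 ∧ ¬ ∀ i, t * x i = t * z i,
          ∏ i, (ω ^ c i) (x i + y u i) := by
      rw [Finset.sum_filter, Finset.sum_filter, ← Equiv.sum_comp (Equiv.addRight (y u))]
      have h1 : ∑ i, y u i = 0 := by simp [y, ← Finset.mul_sum]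
      have h2 (i) : t * y u i = 0 := by simp [y, ← mul_assoc, ht]
      simp [Finset.sum_add_distrib, h1, mul_add, h2]
    have hsum := ((Finset.sum_congr rfl fun u (_ : u ∈ Finset.univ) ↦ hshift u).trans
      Finset.sum_comm).trans (Finset.sum_eq_zero fun x hx ↦ by
        simp only [Finset.mem_filter, Finset.mem_univ, true_and] at hx
        exact sum_prod_pow_add_mul_eq_zero ω ht hω c v hv 0 x hx.1
          (by simpa only [hcrit] using hx.2))
    rw [Finset.sum_const] at hsum
    simpa using hsum
  rw [Finset.filter_filter, Finset.filter_filter, hnot, add_zero,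
    Finset.sum_eq_card_nsmul (b := ∏ i, (ω ^ c i) (z i : R)),
    card_sum_eq_one_and_mul_eq n t _ hz, nsmul_eq_mul, Nat.cast_pow]
  intro x hx
  simp only [Finset.mem_filter, Finset.mem_univ, true_and] at hx
  have hw (i) : ∃ w, x i - z i = t * w := hann _ (by rw [mul_sub, hx.2, sub_self])
  choose w hw using hw
  have hx' (i) : x i = z i + t * w i := by rw [← hw]; ring
  have htw : t * ∑ i, w i = 0 := by
    simp [Finset.mul_sum, ← hw, hx.1, hz]
  simp_rw [hx']
  rw [prod_pow_add_mul ω ht, oneAddMul_apply]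
  have : ∑ i, (c i : R) * (↑(z i)⁻¹ * w i) = v * ∑ i, w i := by
    rw [Finset.mul_sum]
    refine Finset.sum_congr rfl fun i _ ↦ ?_
    rw [← hc']
    simp only [z, mul_inv_rev, inv_inv, Units.val_mul]
    linear_combination (v * w i : R) * (c' i).mul_inv
  rw [this, mul_left_comm, htw]
  simp

end MulChar

namespace DirichletCharacter

/-- If `a` generates the units mod `q`, there is a Dirichlet character mod `q` that is injective on
units and sends `a` to `exp (2 * π * I / φ q)`, and characters are determined by their value at
`a`. -/
lemma exists_generating_character {q : ℕ} [NeZero q] (a : ZMod q) (ha : orderOf a = q.totient) :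
    ∃ ω : DirichletCharacter ℂ q, ω a = exp (2 * Real.pi * I / q.totient) ∧
      (∀ u : (ZMod q)ˣ, ω u = 1 → u = 1) ∧
      ∀ χ χ' : DirichletCharacter ℂ q, χ a = χ' a → χ = χ' := by
  have hφ : 0 < q.totient := Nat.totient_pos.mpr (NeZero.pos q)
  have hfin : IsOfFinOrder a := orderOf_pos_iff.mp (ha ▸ hφ)
  obtain ⟨g, rfl⟩ := hfin.isUnit
  rw [orderOf_units] at ha
  have hg : ∀ x, x ∈ Subgroup.zpowers g := fun x ↦ by
    rw [(Subgroup.zpowers g).eq_top_of_card_eq]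
    · trivial
    · rw [Nat.card_zpowers, ha, Nat.card_eq_fintype_card, ZMod.card_units_eq_totient]
  have hζ := Complex.isPrimitiveRoot_exp q.totient hφ.ne'
  obtain ⟨ζ, hζu⟩ := hζ.isUnit hφ.ne'
  have hord : orderOf ζ = orderOf g := by rw [← orderOf_units, hζu, ← hζ.eq_orderOf, ha]
  let ω : DirichletCharacter ℂ q := MulChar.ofUnitHom (monoidHomOfForallMemZpowers hg hord.dvd)
  have hω : ω g = ζ := by
    simp [ω, monoidHomOfForallMemZpowers_apply_gen]
  refine ⟨ω, hω.trans hζu, fun u hu ↦ ?_, fun χ χ' h ↦ (MulChar.eq_iff hg χ χ').mpr h⟩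
  obtain ⟨k, rfl⟩ := hg u
  have h1 : ω.toUnitHom g = ζ := Units.ext (by rw [MulChar.coe_toUnitHom, hω])
  have h2 : ω.toUnitHom (g ^ k) = 1 := Units.ext (by rw [MulChar.coe_toUnitHom, hu, Units.val_one])
  rw [map_zpow, h1, ← orderOf_dvd_iff_zpow_eq_one, hord] at h2
  exact orderOf_dvd_iff_zpow_eq_one.mp h2

lemma isUnit_natCast_of_isPrimitive_pow {p m : ℕ} [NeZero (p ^ m)] (hp : p.Prime) (hm : 2 ≤ m)
    (ω : DirichletCharacter ℂ (p ^ m)) (c : ℕ) (h : (ω ^ c).IsPrimitive) :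
    IsUnit (c : ZMod (p ^ m)) := by
  rw [ZMod.isUnit_iff_coprime]
  refine Nat.Coprime.pow_right _ (Nat.Coprime.symm ?_)
  rw [hp.coprime_iff_not_dvd]
  rintro ⟨d, rfl⟩
  have hdvd : p ^ (m - 1) ∣ p ^ m := pow_dvd_pow p (Nat.sub_le m 1)
  have hzero {k : ℕ} (hk : m ≤ k) : (p : ZMod (p ^ m)) ^ k = 0 := by
    rw [← Nat.cast_pow, ZMod.natCast_eq_zero_iff]
    exact pow_dvd_pow p hk
  have ht : (p : ZMod (p ^ m)) ^ (m - 1) * (p : ZMod (p ^ m)) ^ (m - 1) = 0 := by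
    rw [← pow_add]
    exact hzero (by omega)
  have hfac : (ω ^ (p * d)).FactorsThrough (p ^ (m - 1)) := by
    rw [factorsThrough_iff_ker_unitsMap hdvd]
    intro x hx
    rw [MonoidHom.mem_ker] at hx ⊢
    refine Units.ext ?_
    rw [MulChar.coe_toUnitHom, Units.val_one]
    obtain ⟨s, hs⟩ : ∃ s, (x : ZMod (p ^ m)) = 1 + (p : ZMod (p ^ m)) ^ (m - 1) * s := by
      have h1 := congrArg Units.val hx
      rw [ZMod.unitsMap_val, Units.val_one] at h1
      obtain ⟨y, hy⟩ := ZMod.intCast_surjective (x : ZMod (p ^ m))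
      rw [← hy, ZMod.cast_intCast hdvd, ← Int.cast_one, ZMod.intCast_eq_intCast_iff_dvd_sub] at h1
      obtain ⟨s, hs⟩ := h1
      refine ⟨((-s : ℤ) : ZMod (p ^ m)), ?_⟩
      rw [← hy, show y = 1 + (p : ℤ) ^ (m - 1) * (-s) by push_cast at hs; linarith]
      push_cast
      rfl
    rw [hs, MulChar.pow_one_add_mul ω ht, MulChar.oneAddMul_apply]
    have : (p : ZMod (p ^ m)) ^ (m - 1) * (((p * d : ℕ) : ZMod (p ^ m)) * s) = 0 := by
      have h2 := hzero (k := m - 1 + 1) (by omega)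
      rw [pow_succ] at h2
      push_cast
      linear_combination (d * s : ZMod (p ^ m)) * h2
    rw [this, add_zero, map_one]
  have h3 := conductor_dvd_of_mem_conductorSet _ hfac
  rw [(isPrimitive_def _).mp h, Nat.pow_dvd_pow_iff_le_right hp.one_lt] at h3
  omega

end DirichletCharacter

lemma ZMod.card_natCast_mul_eq_zero {q d : ℕ} [NeZero q] (hd : d ∣ q) :
    Nat.card {x : ZMod q // (d : ZMod q) * x = 0} = d := by
  have h := IsAddCyclic.card_nsmulAddMonoidHom_ker (G := ZMod q) d
  rw [Nat.card_zmod, Nat.gcd_eq_right hd] at h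
  refine (Nat.card_congr (Equiv.subtypeEquivRight fun x ↦ ?_)).trans h
  simp [AddMonoidHom.mem_ker]

lemma ZMod.exists_eq_mul_of_mul_eq_zero {N : ℕ} [NeZero (N * N)] (d : ZMod (N * N))
    (h : (N : ZMod (N * N)) * d = 0) : ∃ w, d = N * w := by
  obtain ⟨y, rfl⟩ := ZMod.intCast_surjective d
  have hN : (N : ℤ) ≠ 0 := by
    have := NeZero.ne (N * N)
    aesop
  rw [← Int.cast_natCast, ← Int.cast_mul, ZMod.intCast_zmod_eq_zero_iff_dvd, Nat.cast_mul,
    mul_dvd_mul_iff_left hN] at h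
  obtain ⟨w, rfl⟩ := h
  exact ⟨w, by push_cast; rfl⟩

theorem stmt3 {p m k : ℕ} [NeZero (p ^ m)] (hp : p.Prime) (hp2 : p ≠ 2)
    (hk : 2 ≤ k) (hm : 2 ≤ m) (hmeven : Even m)
    -- a primitive root a mod p^m
    (a : ℕ) (ha : orderOf (a : ZMod (p ^ m)) = Nat.totient (p ^ m))
    (χ : Fin k → DirichletCharacter ℂ (p ^ m))
    -- the c_i with χ_i(a) = e(c_i/φ(p^m)), 1 ≤ c_i ≤ φ(p^m)
    (c : Fin k → ℕ) (hcrange : ∀ i, 1 ≤ c i ∧ c i ≤ Nat.totient (p ^ m))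
    (hχa : ∀ i, χ i (a : ZMod (p ^ m)) =
      Complex.exp (2 * Real.pi * Complex.I * (c i) / (Nat.totient (p ^ m))))
    (hprim : ∀ i, (χ i).IsPrimitive)
    (hprodprim : (∏ i, χ i).IsPrimitive)
    (v : ℕ) (hv : v = ∑ i, c i) :
    Jsum χ (1 : ZMod (p ^ m)) =
      (Real.sqrt p : ℂ) ^ (m * (k - 1)) *
        (∏ i, χ i ((c i : ZMod (p ^ m)))) *
        ((∏ i, χ i) ((v : ZMod (p ^ m))))⁻¹ := by
  obtain ⟨ω, hωa, hinj, hext⟩ := DirichletCharacter.exists_generating_character _ ha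
  have hχ (i) : χ i = ω ^ c i := by
    refine hext _ _ ?_
    have hc0 : c i ≠ 0 := Nat.one_le_iff_ne_zero.mp (hcrange i).1
    rw [MulChar.pow_apply' _ hc0, hωa, hχa, ← Complex.exp_nat_mul]
    congr 1
    ring
  obtain rfl : χ = fun i ↦ ω ^ c i := funext hχ
  have hc (i) : IsUnit (c i : ZMod (p ^ m)) :=
    DirichletCharacter.isUnit_natCast_of_isPrimitive_pow hp hm ω _ (hprim i)
  rw [Finset.prod_pow_eq_pow_sum] at hprodprim
  have hsum := DirichletCharacter.isUnit_natCast_of_isPrimitive_pow hp hm ω _ hprodprim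
  obtain ⟨n, rfl⟩ := hmeven
  obtain ⟨l, rfl⟩ : ∃ l, k = l + 1 := ⟨k - 1, by omega⟩
  have hq : p ^ (n + n) = p ^ n * p ^ n := pow_add p n n
  have ht : ((p ^ n : ℕ) : ZMod (p ^ (n + n))) * ((p ^ n : ℕ) : ZMod (p ^ (n + n))) = 0 := by
    rw [← Nat.cast_mul, ← hq, ZMod.natCast_self]
  have hann (d : ZMod (p ^ (n + n))) (hd : ((p ^ n : ℕ) : ZMod (p ^ (n + n))) * d = 0) :
      ∃ w, d = ((p ^ n : ℕ) : ZMod (p ^ (n + n))) * w := by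
    have : NeZero (p ^ n * p ^ n) := hq ▸ inferInstance
    clear * - hq hd this
    generalize p ^ (n + n) = q at *
    subst hq
    exact ZMod.exists_eq_mul_of_mul_eq_zero d hd
  have hω (s : ZMod (p ^ (n + n))) (hs : ω (1 + ((p ^ n : ℕ) : ZMod (p ^ (n + n))) * s) = 1) :
      ((p ^ n : ℕ) : ZMod (p ^ (n + n))) * s = 0 := by
    obtain ⟨u, hu⟩ := MulChar.isUnit_one_add_mul ht s
    rw [← hu] at hs
    rw [hinj u hs] at hu
    simpa using hu.symm
  have hcard := ZMod.card_natCast_mul_eq_zero (q := p ^ (n + n))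
    (pow_dvd_pow p (Nat.le_add_right n n))
  have hmain := MulChar.sum_prod_pow_eq ω ht hann hω c hc (by simpa using hsum)
  rw [hcard] at hmain
  have hsqrt : (Real.sqrt p : ℂ) ^ ((n + n) * l) = ((p ^ n : ℕ) : ℂ) ^ l := by
    rw [pow_mul, ← two_mul, pow_mul, ← Complex.ofReal_pow, Real.sq_sqrt (Nat.cast_nonneg p)]
    push_cast
    rfl
  rw [Jsum, hmain, hv, Nat.cast_sum, Nat.add_sub_cancel, hsqrt]
end

section
/- Let p be an odd prime, m ≥ 2, and let χ1, χ2 be characters mod p^m with associated integers c1, c2. Let b be an integer with p ∤ b and suppose p ∤ c1·c2·(c1+c2). Then J_b(χ1,χ2,p^m) = χ1χ2(b) · χ1(c1) · χ2(c2) · (χ1χ2(c1+c2))^{−1} · p^{m/2} · (−2r/p)^m · (c1 c2 (c1+c2)/p)^m · ε_{p^m}. -/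
open Complex

/-- `ε_q = 1` if `q ≡ 1 (mod 4)` and `i` if `q ≡ 3 (mod 4)`. -/
noncomputable def eps (q : ℕ) : ℂ := if q % 4 = 1 then 1 else Complex.I

/-- The two-character Jacobi sum `J_b(χ₁,χ₂,q) = ∑_{x mod q} χ₁(x) χ₂(b-x)`. -/
noncomputable def Jsum2 {q : ℕ} [NeZero q]
    (χ₁ χ₂ : DirichletCharacter ℂ q) (b : ZMod q) : ℂ :=
  ∑ x : ZMod q, χ₁ x * χ₂ (b - x)

section QuadraticGaussSum

open Polynomial Finset

/-- The Euler operator `P ↦ X * P'`. -/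
noncomputable def eulerOp (R : Type*) [CommRing R] : R[X] →ₗ[R] R[X] :=
  (LinearMap.mulLeft R (X : R[X])) ∘ₗ derivative

theorem eulerOp_apply {R : Type*} [CommRing R] (P : R[X]) :
    eulerOp R P = X * derivative P := rfl

theorem eulerOp_iterate_X_pow {R : Type*} [CommRing R] (n k : ℕ) :
    ((eulerOp R) ^ k) (X ^ n) = C ((n : R) ^ k) * X ^ n := by
  induction k with
  | zero => simp
  | succ k ih =>
    rw [pow_succ', Module.End.mul_apply, ih, eulerOp_apply, derivative_C_mul_X_pow]
    rcases n with _ | n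
    · simp
    · rw [Nat.add_sub_cancel, pow_succ, C_mul]
      push_cast
      simp only [map_add, map_one]
      ring

theorem eulerOp_iterate_eval_one {R : Type*} [CommRing R] (k : ℕ) (P : R[X]) :
    (((eulerOp R) ^ k) ((X - 1) ^ k * P)).eval 1 = (k.factorial : R) * P.eval 1 := by
  induction k generalizing P with
  | zero => simp
  | succ k ih =>
    have : eulerOp R ((X - 1) ^ (k + 1) * P) =
        (X - 1) ^ k * (((k + 1 : ℕ) : R[X]) * X * P + (X - 1) * (X * derivative P)) := by
      rw [eulerOp_apply, derivative_mul, derivative_pow]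
      simp only [Nat.add_sub_cancel, derivative_sub, derivative_X, derivative_one, sub_zero,
        mul_one, map_natCast]
      ring
    rw [pow_succ, Module.End.mul_apply, this, ih, Nat.factorial_succ]
    simp
    ring

theorem prod_X_pow_sub_X_pow {R : Type*} [CommRing R] (p h : ℕ) (hp : 2 * h ≤ p) :
    ∃ Q : R[X], ∏ k ∈ range h, ((X : R[X]) ^ (k + 1) - X ^ (p - (k + 1))) = (X - 1) ^ h * Q ∧
      Q.eval 1 = ∏ k ∈ range h, (2 * ((k + 1 : ℕ) : R) - p) := by
  refine ⟨∏ k ∈ range h, (∑ i ∈ range (k + 1), (X : R[X]) ^ i -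
    ∑ i ∈ range (p - (k + 1)), X ^ i), ?_, ?_⟩
  · conv_rhs => rw [← card_range h, ← prod_const, card_range, ← prod_mul_distrib]
    refine prod_congr rfl fun k _ => ?_
    rw [mul_sub, mul_comm, geom_sum_mul, mul_comm, geom_sum_mul]
    ring
  · rw [eval_prod]
    refine prod_congr rfl fun k hk => ?_
    have := mem_range.1 hk
    simp only [eval_sub, eval_finsetSum, eval_pow, eval_X, one_pow, sum_const, card_range,
      nsmul_eq_mul, mul_one]
    rw [Nat.cast_sub (by omega)]
    ring

theorem factorial_half_sq (p : ℕ) [Fact p.Prime] (hp2 : p ≠ 2) :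
    (((p / 2).factorial : ZMod p)) ^ 2 = (-1) ^ (p / 2 + 1) := by
  have hodd := (Nat.Prime.odd_of_ne_two Fact.out hp2 : Odd p)
  obtain ⟨h, hh⟩ := hodd
  have h2 : p / 2 = h := by omega
  have hw := ZMod.wilsons_lemma p
  have key : ((2 * h).factorial : ZMod p) = (-1) ^ h * (h.factorial : ZMod p) ^ 2 := by
    rw [← prod_range_add_one_eq_factorial, two_mul, prod_range_add, Nat.cast_mul,
      prod_range_add_one_eq_factorial, sq, ← mul_assoc, mul_comm ((-1) ^ h), mul_assoc]
    congr 1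
    rw [← prod_range_reflect, Nat.cast_prod]
    conv_rhs => rw [← card_range h, ← prod_const, card_range, ← prod_range_add_one_eq_factorial,
      Nat.cast_prod, ← prod_mul_distrib]
    refine prod_congr rfl fun k hk => ?_
    have hk := mem_range.1 hk
    have : h + (h - 1 - k) + 1 = p - (k + 1) := by omega
    rw [this, Nat.cast_sub (by omega)]
    simp
  rw [show p - 1 = 2 * h by omega, key] at hw
  have h1 : ((-1 : ZMod p) ^ h) * (-1) ^ h = 1 := by rw [← mul_pow]; simp
  rw [h2, pow_succ]
  linear_combination (-1) ^ h * hw - (h.factorial : ZMod p) ^ 2 * h1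

theorem sign_eq_of_cyclotomic_dvd (p : ℕ) [Fact p.Prime] (hp2 : p ≠ 2) (s : ℤ)
    (hdvd : cyclotomic p ℤ ∣ (∑ j ∈ range p, C (quadraticChar (ZMod p) (j : ZMod p)) * X ^ (2 * j)
      - C s * ∏ k ∈ range (p / 2), (X ^ (k + 1) - X ^ (p - (k + 1))))) :
    (s : ZMod p) = (-1) ^ (p / 2) := by
  have hodd := (Nat.Prime.odd_of_ne_two Fact.out hp2 : Odd p)
  obtain ⟨h, hh⟩ := hodd
  have h2 : p / 2 = h := by omega
  have hpos : 1 ≤ h := by have := (Fact.out : p.Prime).two_le; omega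
  have hc : cyclotomic p (ZMod p) = (X - 1) ^ (p - 1) := by
    have := cyclotomic_mul_prime_eq_pow_of_not_dvd (ZMod p) (n := 1) (p := p)
      (by simpa using (Fact.out : p.Prime).one_lt.ne')
    simpa using this
  have hd := Polynomial.map_dvd (Int.castRingHom (ZMod p)) hdvd
  rw [map_cyclotomic, hc] at hd
  simp only [Polynomial.map_sub, Polynomial.map_sum, Polynomial.map_mul, Polynomial.map_prod,
    Polynomial.map_pow, map_X, map_C] at hd
  obtain ⟨Q, hQ, hQ1⟩ := prod_X_pow_sub_X_pow (R := ZMod p) p (p / 2) (by omega)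
  rw [hQ] at hd
  obtain ⟨T, hT⟩ := hd
  have hT' := congrArg (fun P => (((eulerOp (ZMod p)) ^ h) P).eval 1) hT
  rw [show p - 1 = h + h by omega, pow_add, mul_assoc] at hT'
  simp only [map_sub, map_sum, ← smul_eq_C_mul, map_smul] at hT'
  rw [eulerOp_iterate_eval_one, h2, eval_sub, eval_smul, eulerOp_iterate_eval_one, eval_mul,
    eval_finsetSum, hQ1, h2] at hT'
  simp only [eval_smul, eulerOp_iterate_X_pow] at hT'
  have hA : ∀ j ∈ range p, ((Int.castRingHom (ZMod p)) (quadraticChar (ZMod p) (j : ZMod p))) •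
      eval 1 (C (((2 * j : ℕ) : ZMod p) ^ h) * X ^ (2 * j)) =
      if j = 0 then 0 else (2 : ZMod p) ^ h := by
    intro j hj
    have hj := mem_range.1 hj
    rw [eq_intCast, quadraticChar_eq_pow_of_char_ne_two' (by rwa [ZMod.ringChar_zmod_n]),
      ZMod.card, h2]
    simp only [eval_mul, eval_C, eval_pow, eval_X, one_pow, mul_one, smul_eq_mul]
    split_ifs with h0
    · simp [h0, Nat.one_le_iff_ne_zero.1 hpos]
    · have hj0 : (j : ZMod p) ≠ 0 := by
        rw [Ne, ZMod.natCast_eq_zero_iff]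
        exact Nat.not_dvd_of_pos_of_lt (by omega) hj
      have := ZMod.pow_card_sub_one_eq_one hj0
      rw [show p - 1 = h + h by omega, pow_add] at this
      push_cast
      rw [mul_pow]
      linear_combination 2 ^ h * this
  have hsum : ∀ n : ℕ, ∑ j ∈ range (n + 1), (if j = 0 then 0 else (2 : ZMod p) ^ h) =
      n * 2 ^ h := by
    intro n
    simp [sum_range_succ']
  rw [sum_congr rfl hA, (congrArg range hh : range p = range (2 * h + 1)), hsum] at hT'
  have hX : eval 1 (((X : (ZMod p)[X]) - 1) ^ h) = 0 := by
    simp [Nat.one_le_iff_ne_zero.1 hpos]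
  have hpz : (p : ZMod p) = 0 := by simp
  have h2h : (2 * (h : ZMod p)) = -1 := by
    have hc' : (p : ZMod p) = ((2 * h + 1 : ℕ) : ZMod p) := congrArg _ hh
    rw [hpz] at hc'
    push_cast at hc'
    linear_combination -hc'
  have hprod : ∏ k ∈ range h, (2 * ((k + 1 : ℕ) : ZMod p) - p) = 2 ^ h * (h.factorial) := by
    conv_rhs => rw [← card_range h, ← prod_const, card_range, ← prod_range_add_one_eq_factorial,
      Nat.cast_prod, ← prod_mul_distrib]
    refine prod_congr rfl fun k _ => ?_
    rw [hpz, sub_zero]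
  have hf := factorial_half_sq p hp2
  have h20 : (2 : ZMod p) ^ h ≠ 0 := by
    apply pow_ne_zero
    intro h0
    have : ((2 : ℕ) : ZMod p) = 0 := by exact_mod_cast h0
    rw [ZMod.natCast_eq_zero_iff] at this
    exact hp2 ((Nat.prime_dvd_prime_iff_eq Fact.out Nat.prime_two).1 this)
  rw [hX, hprod, eq_intCast, smul_eq_mul] at hT'
  push_cast at hT'
  rw [h2h] at hT'
  have h1 : ((-1 : ZMod p) ^ h) * (-1) ^ h = 1 := by rw [← mul_pow]; simp
  rw [h2, pow_succ] at hf
  rw [h2]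
  apply mul_left_cancel₀ h20
  linear_combination (-1) ^ h * hT' + s * 2 ^ h * (-1) ^ h * hf - s * 2 ^ h * h1

theorem prod_one_sub_primitiveRoot_pow (p : ℕ) [Fact p.Prime] {ζ : ℂ} (hζ : IsPrimitiveRoot ζ p) :
    ∏ k ∈ range (p - 1), (1 - ζ ^ (k + 1)) = p := by
  have hp : p.Prime := Fact.out
  rw [← eval_one_cyclotomic_prime (R := ℂ) (p := p), cyclotomic_eq_prod_X_sub_primitiveRoots hζ,
    eval_prod]
  simp only [eval_sub, eval_X, eval_C]
  refine prod_bij (fun k _ => ζ ^ (k + 1)) ?_ ?_ ?_ ?_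
  · intro k hk
    have := mem_range.1 hk
    rw [mem_primitiveRoots hp.pos]
    refine hζ.pow_of_coprime _ ((Nat.coprime_comm.1 ((Nat.Prime.coprime_iff_not_dvd hp).2 ?_)))
    exact Nat.not_dvd_of_pos_of_lt (by omega) (by omega)
  · intro a ha b hb hab
    have := mem_range.1 ha
    have := mem_range.1 hb
    have := hζ.pow_inj (by omega) (by omega) hab
    omega
  · intro x hx
    rw [mem_primitiveRoots hp.pos] at hx
    obtain ⟨i, hi, rfl⟩ := hζ.eq_pow_of_pow_eq_one hx.pow_eq_one
    have hi0 : i ≠ 0 := by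
      rintro rfl
      exact hp.one_lt.ne' (hx.unique (by simp))
    exact ⟨i - 1, mem_range.2 (by omega), by rw [Nat.sub_add_cancel (by omega)]⟩
  · intros
    rfl

theorem prod_half_sq (p : ℕ) [Fact p.Prime] (hp2 : p ≠ 2) {ω : ℂ} (hω : IsPrimitiveRoot ω p) :
    (∏ k ∈ range (p / 2), (ω ^ (k + 1) - ω ^ (p - (k + 1)))) ^ 2 = (-1) ^ (p / 2) * p := by
  have hp : p.Prime := Fact.out
  have hodd : Odd p := hp.odd_of_ne_two hp2
  have h2 : IsPrimitiveRoot (ω ^ 2) p :=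
    hω.pow_of_coprime _ (Nat.coprime_two_left.2 hodd)
  obtain ⟨h, hh⟩ := hodd
  have hh2 : p / 2 = h := by omega
  rw [← prod_one_sub_primitiveRoot_pow p h2, hh2, show p - 1 = h + h by omega, prod_range_add,
    ← prod_range_reflect (fun x => 1 - (ω ^ 2) ^ (h + x + 1)), ← prod_mul_distrib, ← prod_pow]
  conv_rhs => rw [← card_range h, ← prod_const, card_range, ← prod_mul_distrib]
  refine prod_congr rfl fun k hk => ?_
  have := mem_range.1 hk
  rw [show h + (h - 1 - k) + 1 = p - (k + 1) by omega, ← pow_mul, ← pow_mul, mul_comm 2, mul_comm 2,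
    pow_mul, pow_mul]
  have hab : ω ^ (k + 1) * ω ^ (p - (k + 1)) = 1 := by
    rw [← pow_add, show k + 1 + (p - (k + 1)) = p by omega, hω.pow_eq_one]
  linear_combination (ω ^ (k + 1) * ω ^ (p - (k + 1)) - 1) * hab

theorem sum_zmod_eq_sum_range {M : Type*} [AddCommMonoid M] (n : ℕ) [NeZero n] (f : ZMod n → M) :
    ∑ x, f x = ∑ j ∈ range n, f (j : ZMod n) := by
  refine sum_nbij' (fun x => ZMod.val x) (fun j => (j : ZMod n)) ?_ ?_ ?_ ?_ ?_
  · intro x _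
    exact mem_range.2 x.val_lt
  · simp
  · intro x _
    simp
  · intro j hj
    exact ZMod.val_cast_of_lt (mem_range.1 hj)
  · intro x _
    simp

/-- The complex-valued quadratic character of `ZMod p`. -/
noncomputable def quadC (p : ℕ) [Fact p.Prime] : MulChar (ZMod p) ℂ :=
  (quadraticChar (ZMod p)).ringHomComp (Int.castRingHom ℂ)

theorem gaussSum_quadC_sq (p : ℕ) [Fact p.Prime] (hp2 : p ≠ 2) :
    gaussSum (quadC p) ZMod.stdAddChar ^ 2 = (-1) ^ (p / 2) * p := by
  have hc : ringChar (ZMod p) ≠ 2 := by rwa [ZMod.ringChar_zmod_n]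
  rw [quadC, gaussSum_sq _ ((quadraticChar_isQuadratic (ZMod p)).comp _)
    (ZMod.isPrimitive_stdAddChar p)]
  · rw [MulChar.ringHomComp_apply, quadraticChar_neg_one hc, ZMod.card,
      ZMod.χ₄_eq_neg_one_pow ((Nat.Prime.mod_two_eq_one_iff_ne_two Fact.out).2 hp2)]
    simp
  · exact (MulChar.ringHomComp_ne_one_iff (Int.cast_injective)).2 (quadraticChar_ne_one hc)

theorem gaussSum_quadC_eq_prod (p : ℕ) [Fact p.Prime] (hp2 : p ≠ 2) {ω : ℂ}
    (hω : IsPrimitiveRoot ω p) (hω2 : ω ^ 2 = Complex.exp (2 * Real.pi * Complex.I / p)) :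
    gaussSum (quadC p) ZMod.stdAddChar =
      (-1) ^ (p / 2) * ∏ k ∈ range (p / 2), (ω ^ (k + 1) - ω ^ (p - (k + 1))) := by
  have hp : p.Prime := Fact.out
  set Q := ∏ k ∈ range (p / 2), (ω ^ (k + 1) - ω ^ (p - (k + 1))) with hQ
  have hG : gaussSum (quadC p) ZMod.stdAddChar =
      ∑ j ∈ range p, (quadraticChar (ZMod p) (j : ZMod p) : ℂ) * ω ^ (2 * j) := by
    rw [gaussSum, sum_zmod_eq_sum_range]
    refine sum_congr rfl fun j _ => ?_
    rw [pow_mul, hω2, ← Complex.exp_nat_mul]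
    congr 1
    have := ZMod.stdAddChar_coe (N := p) j
    push_cast at this
    rw [this]
    congr 1
    ring
  have hsq : gaussSum (quadC p) ZMod.stdAddChar ^ 2 = Q ^ 2 := by
    rw [gaussSum_quadC_sq p hp2, prod_half_sq p hp2 hω]
  have key : ∀ s : ℤ, gaussSum (quadC p) ZMod.stdAddChar = s * Q →
      (s : ZMod p) = (-1) ^ (p / 2) := by
    intro s hs
    apply sign_eq_of_cyclotomic_dvd p hp2 s
    rw [cyclotomic_eq_minpoly hω hp.pos]
    apply minpoly.isIntegrallyClosed_dvd (hω.isIntegral hp.pos)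
    simp only [map_sub, map_sum, map_mul, map_prod, map_pow, aeval_X, aeval_C]
    simp only [algebraMap_int_eq, eq_intCast]
    rw [← hG, ← hQ, hs, sub_self]
  have hsgn : ∀ s t : ℤ, (s = 1 ∨ s = -1) → (t = 1 ∨ t = -1) → (s : ZMod p) = (t : ZMod p) →
      s = t := by
    intro s t hs ht hst
    rw [ZMod.intCast_eq_intCast_iff_dvd_sub] at hst
    have h3 : (3 : ℤ) ≤ p := by
      have := hp.two_le
      omega
    by_contra hne
    rcases hs with rfl | rfl <;> rcases ht with rfl | rfl
    · exact hne rfl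
    · have := Int.le_of_dvd (by decide) ((dvd_neg.2 hst : (p : ℤ) ∣ - (-1 - 1)))
      omega
    · have := Int.le_of_dvd (by decide) hst
      omega
    · exact hne rfl
  have hpow : ((-1 : ℤ) ^ (p / 2) = 1 ∨ (-1 : ℤ) ^ (p / 2) = -1) := neg_one_pow_eq_or ℤ _
  rcases sq_eq_sq_iff_eq_or_eq_neg.1 hsq with h | h
  · have := hsgn 1 _ (Or.inl rfl) hpow (by push_cast; exact_mod_cast key 1 (by simpa using h))
    have h' : (1 : ℂ) = (-1) ^ (p / 2) := by exact_mod_cast congrArg (Int.cast : ℤ → ℂ) this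
    rw [h, ← h', one_mul]
  · have := hsgn (-1) _ (Or.inr rfl) hpow
      (by push_cast; simpa using key (-1) (by simpa using h))
    have h' : (-1 : ℂ) = (-1) ^ (p / 2) := by exact_mod_cast congrArg (Int.cast : ℤ → ℂ) this
    rw [h, ← h', neg_one_mul]

theorem gaussSum_quadC (p : ℕ) [Fact p.Prime] (hp2 : p ≠ 2) :
    gaussSum (quadC p) ZMod.stdAddChar = eps p * (Real.sqrt p : ℂ) := by
  have hp : p.Prime := Fact.out
  have hp0 : (p : ℂ) ≠ 0 := by exact_mod_cast hp.ne_zero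
  obtain ⟨h, hh⟩ := hp.odd_of_ne_two hp2
  have hh2 : p / 2 = h := by omega
  set η : ℂ := Complex.exp (Real.pi * Complex.I / p) with hη
  have hηp : η ^ p = -1 := by
    rw [hη, ← Complex.exp_nat_mul, mul_div_cancel₀ _ hp0, Complex.exp_pi_mul_I]
  have hη2 : η ^ 2 = Complex.exp (2 * Real.pi * Complex.I / p) := by
    rw [hη, ← Complex.exp_nat_mul]
    congr 1
    push_cast
    ring
  have hω : IsPrimitiveRoot (-η) p := by
    have h1 : -η = (η ^ 2) ^ (h + 1) := by
      rw [← pow_mul, show 2 * (h + 1) = p + 1 by omega, pow_succ, hηp]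
      ring
    rw [h1, hη2]
    refine (Complex.isPrimitiveRoot_exp p hp.ne_zero).pow_of_coprime _ ?_
    refine Nat.coprime_comm.1 ((Nat.Prime.coprime_iff_not_dvd hp).2 ?_)
    exact Nat.not_dvd_of_pos_of_lt (by omega) (by have := hp.two_le; omega)
  have hprod := gaussSum_quadC_eq_prod p hp2 hω (by rw [neg_sq, hη2])
  have hterm : ∀ k ∈ range h, (-η) ^ (k + 1) - (-η) ^ (p - (k + 1)) =
      (-1) * Complex.I ^ (2 * k + 1) * ((2 * Real.sin (Real.pi * (k + 1) / p) : ℝ) : ℂ) := by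
    intro k hk
    have hk := mem_range.1 hk
    set x : ℂ := Real.pi * (k + 1) / p with hx
    have hηk : η ^ (k + 1) = Complex.exp (x * Complex.I) := by
      rw [hη, ← Complex.exp_nat_mul]
      congr 1
      push_cast
      ring
    have hinv : (-η) ^ (k + 1) * (-η) ^ (p - (k + 1)) = 1 := by
      rw [← pow_add, show k + 1 + (p - (k + 1)) = p by omega, hω.pow_eq_one]
    have hs : ((-1 : ℂ) ^ (k + 1)) * (-1) ^ (k + 1) = 1 := by rw [← mul_pow]; simp
    have hexp : Complex.exp (x * Complex.I) * Complex.exp (-x * Complex.I) = 1 := by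
      rw [← Complex.exp_add]
      simp
    have h1 : (-η) ^ (k + 1) = (-1) ^ (k + 1) * Complex.exp (x * Complex.I) := by
      rw [neg_pow, hηk]
    have h2 : (-η) ^ (p - (k + 1)) = (-1) ^ (k + 1) * Complex.exp (-x * Complex.I) := by
      rw [h1] at hinv
      linear_combination (-1) ^ (k + 1) * Complex.exp (-x * Complex.I) * hinv
        - (-η) ^ (p - (k + 1)) * hs * (Complex.exp (x * Complex.I) * Complex.exp (-x * Complex.I))
        - (-η) ^ (p - (k + 1)) * hexp
    have h3 : ((2 * Real.sin (Real.pi * (k + 1) / p) : ℝ) : ℂ) = 2 * Complex.sin x := by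
      push_cast
      rw [hx]
    rw [h1, h2, h3, Complex.exp_mul_I, Complex.exp_mul_I, Complex.cos_neg, Complex.sin_neg,
      pow_succ Complex.I, pow_mul, Complex.I_sq]
    ring
  have hI : ∀ n : ℕ, ∏ k ∈ range n, (Complex.I ^ (2 * k + 1)) = Complex.I ^ (n ^ 2) := by
    intro n
    induction n with
    | zero => simp
    | succ n ih => rw [prod_range_succ, ih, ← pow_add]; congr 1; ring
  rw [hh2, prod_congr rfl hterm, prod_mul_distrib, prod_mul_distrib, hI, prod_const, card_range,
    ← Complex.ofReal_prod] at hprod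
  set S := ∏ k ∈ range h, (2 * Real.sin (Real.pi * (k + 1) / p)) with hS
  have hSpos : 0 < S := by
    refine prod_pos fun k hk => ?_
    have hk := mem_range.1 hk
    have hpR : (0 : ℝ) < p := by exact_mod_cast hp.pos
    refine mul_pos two_pos (Real.sin_pos_of_pos_of_lt_pi (by positivity) ?_)
    rw [div_lt_iff₀ hpR]
    refine mul_lt_mul_of_pos_left ?_ Real.pi_pos
    exact_mod_cast (by omega : k + 1 < p)
  have hI2 : Complex.I ^ (h ^ 2) = eps p := by
    rw [eps]
    rcases Nat.even_or_odd' h with ⟨l, rfl | rfl⟩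
    · rw [if_pos (by omega), show (2 * l) ^ 2 = 4 * l ^ 2 by ring, pow_mul, Complex.I_pow_four,
        one_pow]
    · rw [if_neg (by omega), show (2 * l + 1) ^ 2 = 4 * (l ^ 2 + l) + 1 by ring, pow_succ, pow_mul,
        Complex.I_pow_four, one_pow, one_mul]
  have h11 : ((-1 : ℂ) ^ h) * (-1) ^ h = 1 := by rw [← mul_pow]; simp
  have hG : gaussSum (quadC p) ZMod.stdAddChar = eps p * (S : ℂ) := by
    rw [hprod, hI2]
    linear_combination (eps p * (S : ℂ)) * h11
  have hsq := gaussSum_quadC_sq p hp2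
  have heps : eps p ^ 2 = (-1) ^ (p / 2) := by
    rw [← hI2, ← pow_mul, mul_comm, pow_mul, Complex.I_sq, hh2]
    rcases Nat.even_or_odd h with h | h
    · rw [h.neg_one_pow, (h.pow_of_ne_zero two_ne_zero).neg_one_pow]
    · rw [h.neg_one_pow, h.pow.neg_one_pow]
  rw [hG, mul_pow, heps, hh2] at hsq
  have hS2 : (S : ℂ) ^ 2 = p := by
    linear_combination (-1) ^ h * hsq - ((S : ℂ) ^ 2 - p) * h11
  have hS2' : S ^ 2 = p := by exact_mod_cast hS2
  rw [hG, ← hS2', Real.sqrt_sq hSpos.le]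

theorem sum_stdAddChar_mul_sq (p : ℕ) [Fact p.Prime] (hp2 : p ≠ 2) {d : ZMod p} (hd : d ≠ 0) :
    ∑ t : ZMod p, ZMod.stdAddChar (d * t ^ 2) = quadC p d * (eps p * (Real.sqrt p : ℂ)) := by
  classical
  have hc : ringChar (ZMod p) ≠ 2 := by rwa [ZMod.ringChar_zmod_n]
  have h1 : ∑ t : ZMod p, (ZMod.stdAddChar (d * t ^ 2) : ℂ) =
      ∑ s : ZMod p, (quadC p s + 1) * ZMod.stdAddChar (d * s) := by
    rw [← sum_fiberwise (s := univ) (g := fun t : ZMod p => t ^ 2)]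
    refine sum_congr rfl fun s _ => ?_
    rw [sum_congr rfl (g := fun _ => (ZMod.stdAddChar (d * s) : ℂ))
      (fun t ht => by rw [(mem_filter.1 ht).2]), sum_const, nsmul_eq_mul]
    congr 1
    have := quadraticChar_card_sqrts hc s
    have h' : (#{t : ZMod p | t ^ 2 = s} : ℤ) = quadraticChar (ZMod p) s + 1 := by
      rw [← this]
      congr 2
      ext
      simp
    have h'' := congrArg (Int.cast : ℤ → ℂ) h'
    push_cast at h''
    exact h''
  have h2 := gaussSum_mulShift (quadC p) (ZMod.stdAddChar (N := p)) (Units.mk0 d hd)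
  rw [Units.val_mk0] at h2
  have h3 : quadC p d * quadC p d = 1 := by
    rw [← map_mul, ← sq, quadC, MulChar.ringHomComp_apply, quadraticChar_sq_one' hd, map_one]
  have h4 := AddChar.sum_mulShift d (ZMod.isPrimitive_stdAddChar p)
  rw [if_neg hd] at h4
  simp only [mul_comm _ d, Nat.cast_zero] at h4
  rw [h1]
  simp only [add_mul, one_mul, sum_add_distrib]
  rw [h4, add_zero, ← gaussSum_quadC p hp2, ← h2, ← mul_assoc, h3, one_mul]
  rfl

end QuadraticGaussSum

section PrimePowerCharacters

open Finset

theorem one_add_pow_eq {R : Type*} [CommRing R] (z : R) (N : ℕ) :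
    ∃ q, (1 + z) ^ N = 1 + N * z + N.choose 2 * z ^ 2 + z ^ 3 * q := by
  induction N with
  | zero => exact ⟨0, by simp⟩
  | succ N ih =>
    obtain ⟨q, hq⟩ := ih
    refine ⟨N.choose 2 + q + z * q, ?_⟩
    rw [pow_succ, hq, Nat.choose_succ_succ' N 1, Nat.choose_one_right]
    push_cast
    ring

theorem exists_pow_eq_one_add {p : ℕ} (hp : p.Prime) (hp2 : p ≠ 2) {a r : ℤ}
    (hr : a ^ (p - 1) = 1 + r * p) (k : ℕ) :
    ∃ s w : ℤ, a ^ ((p - 1) * p ^ k) = 1 + p ^ (k + 1) * s ∧ s = r + p * w := by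
  induction k with
  | zero => exact ⟨r, 0, by simp [hr, mul_comm], by simp⟩
  | succ k ih =>
    obtain ⟨s, w, hs, hw⟩ := ih
    obtain ⟨h, hh⟩ := hp.odd_of_ne_two hp2
    obtain ⟨q, hq⟩ := one_add_pow_eq ((p : ℤ) ^ (k + 1) * s) p
    have hch : p.choose 2 = p * h := by
      rw [Nat.choose_two_right, show p - 1 = 2 * h by omega, mul_left_comm, Nat.mul_div_cancel_left]
      norm_num
    refine ⟨s + p * (h * p ^ k * s ^ 2 + p ^ (2 * k) * s ^ 3 * q),
      w + (h * p ^ k * s ^ 2 + p ^ (2 * k) * s ^ 3 * q), ?_, by rw [hw]; ring⟩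
    rw [pow_succ p k, ← mul_assoc, pow_mul, hs, hq, hch]
    push_cast
    ring

theorem not_dvd_of_orderOf_eq {p m : ℕ} (hp : p.Prime) (hp2 : p ≠ 2) (hm : 2 ≤ m) {a : ℕ}
    (ha : orderOf (a : ZMod (p ^ m)) = Nat.totient (p ^ m)) {r : ℤ}
    (hr : (a : ℤ) ^ (p - 1) = 1 + r * p) : ¬ (p : ℤ) ∣ r := by
  rintro ⟨t, rfl⟩
  obtain ⟨m, rfl⟩ := Nat.exists_eq_add_of_le' hm
  obtain ⟨s, w, hs, rfl⟩ := exists_pow_eq_one_add hp hp2 hr m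
  have h1 : (a : ZMod (p ^ (m + 2))) ^ ((p - 1) * p ^ m) = 1 := by
    have := congrArg (Int.cast : ℤ → ZMod (p ^ (m + 2))) hs
    have hz : (p : ZMod (p ^ (m + 2))) ^ (m + 2) = 0 := by
      exact_mod_cast ZMod.natCast_self (p ^ (m + 2))
    push_cast at this
    rw [this]
    linear_combination (t + w : ZMod (p ^ (m + 2))) * hz
  have h2 := Nat.le_of_dvd (Nat.mul_pos (by have := hp.two_le; omega) (pow_pos hp.pos _))
    (orderOf_dvd_of_pow_eq_one h1)
  rw [ha, Nat.totient_prime_pow hp (by omega), mul_comm] at h2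
  have h3 := Nat.le_of_mul_le_mul_left h2 (by have := hp.two_le; omega)
  exact absurd h3 (not_le.2 (Nat.pow_lt_pow_right hp.one_lt (by omega)))

theorem exists_generating_character {q : ℕ} [NeZero q] {a : ZMod q}
    (ha : orderOf a = Nat.totient q) :
    ∃ θ : DirichletCharacter ℂ q,
      θ a = Complex.exp (2 * Real.pi * Complex.I / Nat.totient q) ∧
      ∀ (χ : DirichletCharacter ℂ q) (c : ℕ),
        χ a = Complex.exp (2 * Real.pi * Complex.I * c / Nat.totient q) → χ = θ ^ c := by
  have hpos : 0 < Nat.totient q := Nat.totient_pos.2 (NeZero.pos q)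
  have hu : IsUnit a := (orderOf_pos_iff.1 (ha ▸ hpos)).isUnit
  obtain ⟨u, rfl⟩ := hu
  rw [orderOf_units] at ha
  have hgen : ∀ x, x ∈ Subgroup.zpowers u := by
    have : Subgroup.zpowers u = ⊤ := by
      apply Subgroup.eq_top_of_card_eq
      rw [Nat.card_zpowers, ha, Nat.card_eq_fintype_card, ZMod.card_units_eq_totient]
    intro x
    rw [this]
    trivial
  have hprim := Complex.isPrimitiveRoot_exp _ hpos.ne'
  have hdvd : orderOf (Units.mk0 _ (Complex.exp_ne_zero
      (2 * Real.pi * Complex.I / Nat.totient q))) ∣ orderOf u := by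
    rw [ha]
    apply orderOf_dvd_of_pow_eq_one
    ext
    exact hprim.pow_eq_one
  refine ⟨MulChar.ofUnitHom (monoidHomOfForallMemZpowers hgen hdvd), ?_, ?_⟩
  · rw [MulChar.ofUnitHom_coe, monoidHomOfForallMemZpowers_apply_gen, Units.val_mk0]
  · intro χ c hχ
    ext x
    obtain ⟨j, rfl⟩ := (mem_powers_iff_mem_zpowers.2 (hgen x))
    simp only [Units.val_pow_eq_pow_val, map_pow]
    congr 1
    rw [hχ, MulChar.pow_apply_coe, MulChar.ofUnitHom_coe, monoidHomOfForallMemZpowers_apply_gen,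
      Units.val_mk0, ← Complex.exp_nat_mul]
    congr 1
    ring

theorem isUnit_intCast_of_not_dvd {p m : ℕ} (hp : p.Prime) {s : ℤ} (hs : ¬ (p : ℤ) ∣ s) :
    IsUnit (s : ZMod (p ^ m)) := by
  rw [ZMod.coe_int_isUnit_iff_isCoprime]
  push_cast
  exact ((Nat.prime_iff_prime_int.1 hp).coprime_iff_not_dvd.2 hs).pow_left

/-- On the subgroup `1 + p ^ k ℤ` with `m ≤ 2 * k`, a generating character is an additive
character. -/
theorem character_one_add_eq_stdAddChar {p m : ℕ} [NeZero (p ^ m)] (hp : p.Prime) (hp2 : p ≠ 2)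
    {a : ℕ} {r : ℤ} (hr : (a : ℤ) ^ (p - 1) = 1 + r * p) (hpr : ¬ (p : ℤ) ∣ r)
    {θ : DirichletCharacter ℂ (p ^ m)}
    (hθ : θ (a : ZMod (p ^ m)) = Complex.exp (2 * Real.pi * Complex.I / Nat.totient (p ^ m)))
    {k : ℕ} (hk : 1 ≤ k) (hkm : m ≤ 2 * k) (hm : 1 ≤ m) :
    ∃ ρ w : ZMod (p ^ m), IsUnit ρ ∧ ρ * r = 1 + p * w ∧
      ∀ u : ZMod (p ^ m), θ (1 + (p : ZMod (p ^ m)) ^ k * u) =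
        ZMod.stdAddChar (ρ * (p : ZMod (p ^ m)) ^ k * u) := by
  obtain ⟨k, rfl⟩ := Nat.exists_eq_add_of_le' hk
  obtain ⟨m, rfl⟩ := Nat.exists_eq_add_of_le' hm
  obtain ⟨s, w, hs, hw⟩ := exists_pow_eq_one_add hp hp2 hr k
  have hps : ¬ (p : ℤ) ∣ s := by
    rw [hw]
    exact fun h => hpr ((Int.dvd_add_left (Dvd.intro _ rfl)).1 h)
  obtain ⟨v, hv⟩ := isUnit_intCast_of_not_dvd (m := m + 1) hp hps
  have hvs : (↑v⁻¹ : ZMod (p ^ (m + 1))) * s = 1 := by rw [← hv, Units.inv_mul]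
  refine ⟨↑v⁻¹, -(↑v⁻¹ * w), Units.isUnit _, ?_, ?_⟩
  · rw [hw] at hvs
    push_cast at hvs
    linear_combination hvs
  intro u
  set j := ((↑v⁻¹ : ZMod (p ^ (m + 1))) * u).val with hj
  have hj' : (j : ZMod (p ^ (m + 1))) = ↑v⁻¹ * u := ZMod.natCast_zmod_val _
  have hz : (p : ZMod (p ^ (m + 1))) ^ (m + 1) = 0 := by
    exact_mod_cast ZMod.natCast_self (p ^ (m + 1))
  have hpow : (a : ZMod (p ^ (m + 1))) ^ ((p - 1) * p ^ k * j) =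
      1 + (p : ZMod (p ^ (m + 1))) ^ (k + 1) * u := by
    have h1 := congrArg (Int.cast : ℤ → ZMod (p ^ (m + 1))) hs
    push_cast at h1
    obtain ⟨q, hq⟩ := one_add_pow_eq ((p : ZMod (p ^ (m + 1))) ^ (k + 1) * s) j
    have h2 : (p : ZMod (p ^ (m + 1))) ^ (2 * (k + 1)) = 0 := by
      obtain ⟨l, hl⟩ := Nat.exists_eq_add_of_le hkm
      rw [hl, pow_add (p : ZMod (p ^ (m + 1))) (m + 1) l, hz, zero_mul]
    rw [pow_mul, h1, hq, hj']
    linear_combination (p : ZMod (p ^ (m + 1))) ^ (k + 1) * u * hvs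
      + (j.choose 2 * s ^ 2 + p ^ (k + 1) * s ^ 3 * q : ZMod (p ^ (m + 1))) * h2
  rw [← hpow, map_pow, hθ, ← Complex.exp_nat_mul]
  have h3 : (↑v⁻¹ : ZMod (p ^ (m + 1))) * (p : ZMod (p ^ (m + 1))) ^ (k + 1) * u =
      (((p : ℤ) ^ (k + 1) * j : ℤ) : ZMod (p ^ (m + 1))) := by
    push_cast
    rw [hj']
    ring
  rw [h3, ZMod.stdAddChar_coe]
  congr 1
  rw [Nat.totient_prime_pow hp (by omega)]
  have hp0 : (p : ℂ) ≠ 0 := by exact_mod_cast hp.ne_zero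
  have hp1 : (p : ℂ) - 1 ≠ 0 := by
    rw [sub_ne_zero]
    exact_mod_cast hp.one_lt.ne'
  push_cast [Nat.cast_sub hp.one_le]
  field_simp
  ring

end PrimePowerCharacters

section StationaryPhase

open Finset

theorem card_mul_sum_comp_eq {G H : Type*} [AddCommGroup G] [AddCommGroup H] [Fintype G]
    [Fintype H] {f : G →+ H} (hf : Function.Surjective f) (F : H → ℂ) :
    (Fintype.card H : ℂ) * ∑ g, F (f g) = Fintype.card G * ∑ h, F h := by
  have h1 : ∀ h, ∑ g, F (f g + h) = ∑ g, F (f g) := by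
    intro h
    obtain ⟨g₀, rfl⟩ := hf h
    simp_rw [← map_add]
    exact Equiv.sum_comp (Equiv.addRight g₀) fun g => F (f g)
  have h2 : ∀ g, ∑ h, F (f g + h) = ∑ h, F h := fun g => Equiv.sum_comp (Equiv.addLeft (f g)) F
  calc (Fintype.card H : ℂ) * ∑ g, F (f g) = ∑ h, ∑ g, F (f g + h) := by simp [h1]
    _ = ∑ g, ∑ h, F (f g + h) := sum_comm
    _ = Fintype.card G * ∑ h, F h := by simp [h2]

theorem pow_mul_eq_zero_iff_exists {p n k : ℕ} [NeZero (p ^ (n + k))] (hp : p ≠ 0)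
    (d : ZMod (p ^ (n + k))) :
    (p : ZMod (p ^ (n + k))) ^ k * d = 0 ↔ ∃ v, (p : ZMod (p ^ (n + k))) ^ n * v = d := by
  have hz : (p : ZMod (p ^ (n + k))) ^ (n + k) = 0 := by
    exact_mod_cast ZMod.natCast_self (p ^ (n + k))
  constructor
  · intro h
    obtain ⟨j, rfl⟩ := ZMod.natCast_zmod_surjective d
    have h1 : p ^ (n + k) ∣ p ^ k * j := by
      rw [← ZMod.natCast_eq_zero_iff]
      exact_mod_cast h
    rw [add_comm, pow_add] at h1
    obtain ⟨i, rfl⟩ := Nat.dvd_of_mul_dvd_mul_left (pow_pos (Nat.pos_of_ne_zero hp) k) h1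
    exact ⟨i, by push_cast; ring⟩
  · rintro ⟨v, rfl⟩
    linear_combination v * hz

theorem sum_comp_pow_mul {p n k : ℕ} [NeZero (p ^ (n + k))] (hp : p ≠ 0)
    (F : ZMod (p ^ (n + k)) → ℂ) :
    ∑ v, F ((p : ZMod (p ^ (n + k))) ^ n * v) =
      p ^ n * ∑ d with (p : ZMod (p ^ (n + k))) ^ k * d = 0, F d := by
  classical
  set f := AddMonoidHom.mulLeft ((p : ZMod (p ^ (n + k))) ^ n) with hfdef
  have hmem : ∀ d, d ∈ f.range ↔ (p : ZMod (p ^ (n + k))) ^ k * d = 0 := fun d =>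
    (pow_mul_eq_zero_iff_exists hp d).symm
  have hcard : Fintype.card f.range = p ^ k := by
    have : f.range = AddSubgroup.zmultiples ((p ^ n : ℕ) : ZMod (p ^ (n + k))) := by
      ext d
      rw [AddSubgroup.mem_zmultiples_iff]
      constructor
      · rintro ⟨v, rfl⟩
        obtain ⟨j, rfl⟩ := ZMod.intCast_surjective v
        exact ⟨j, by simp [hfdef, mul_comm]⟩
      · rintro ⟨j, rfl⟩
        exact ⟨j, by simp [hfdef, mul_comm]⟩
    rw [← Nat.card_eq_fintype_card, this, Nat.card_zmultiples,
      ZMod.addOrderOf_coe _ (NeZero.ne _), pow_add, Nat.gcd_mul_right_left,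
      Nat.mul_div_cancel_left _ (pow_pos (Nat.pos_of_ne_zero hp) n)]
  have h := card_mul_sum_comp_eq f.rangeRestrict_surjective fun d => F d
  have hp' : (p : ℂ) ^ k ≠ 0 := pow_ne_zero _ (Nat.cast_ne_zero.2 hp)
  rw [hcard, ZMod.card] at h
  have hsum : ∑ d : f.range, F d = ∑ d with (p : ZMod (p ^ (n + k))) ^ k * d = 0, F d :=
    (sum_subtype _ (fun d => by simp [hmem]) F).symm
  rw [hsum] at h
  push_cast at h
  apply mul_left_cancel₀ hp'
  refine h.trans ?_
  ring

theorem Jsum2_eq_mul_Jsum2_one {q : ℕ} [NeZero q] (χ₁ χ₂ : DirichletCharacter ℂ q) {b : ZMod q}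
    (hb : IsUnit b) : Jsum2 χ₁ χ₂ b = (χ₁ * χ₂) b * Jsum2 χ₁ χ₂ 1 := by
  obtain ⟨b, rfl⟩ := hb
  rw [Jsum2, Jsum2, mul_sum, ← Equiv.sum_comp (Units.mulLeft b)]
  refine sum_congr rfl fun x _ => ?_
  rw [Units.mulLeft_apply, show (b : ZMod q) - b * x = b * (1 - x) by ring, map_mul, map_mul,
    MulChar.mul_apply]
  ring

theorem isUnit_add_mul_iff {R : Type*} [CommRing R] {P : R} (hP : IsNilpotent P) (x z : R) :
    IsUnit (x + P * z) ↔ IsUnit x := by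
  have h := (Commute.all P z).isNilpotent_mul_right hP
  constructor
  · intro hu
    simpa using (h.neg.isUnit_add_left_of_commute hu (Commute.all _ _))
  · intro hu
    exact h.isUnit_add_left_of_commute hu (Commute.all _ _)

/-- If `χ₁` and `χ₂` are additive on `1 + P R` with frequencies `s₁` and `s₂`, only the points
with `P (x - x₀) = 0` contribute to the Jacobi sum. -/
theorem Jsum2_one_eq_sum_filter {q : ℕ} [NeZero q] {P : ZMod q} (hP : IsNilpotent P)
    (χ₁ χ₂ : DirichletCharacter ℂ q) {s₁ s₂ x₀ : ZMod q}
    (h₁ : ∀ u, χ₁ (1 + P * u) = ZMod.stdAddChar (s₁ * P * u))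
    (h₂ : ∀ u, χ₂ (1 + P * u) = ZMod.stdAddChar (s₂ * P * u))
    (hs : IsUnit (s₁ + s₂)) (hx₀ : (s₁ + s₂) * x₀ = s₁) :
    Jsum2 χ₁ χ₂ 1 = ∑ d with P * d = 0, χ₁ (x₀ + d) * χ₂ (1 - (x₀ + d)) := by
  have key : ∀ x, ∑ z, χ₁ (x + P * z) * χ₂ (1 - (x + P * z)) =
      if P * (x - x₀) = 0 then (q : ℂ) * (χ₁ x * χ₂ (1 - x)) else 0 := by
    intro x
    have e2 : ∀ z, 1 - (x + P * z) = (1 - x) + P * (-z) := fun z => by ring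
    by_cases hx : IsUnit x
    · by_cases hy : IsUnit (1 - x)
      · obtain ⟨y, hy'⟩ := hx.exists_right_inv
        obtain ⟨w, hw⟩ := hy.exists_right_inv
        have h3 : ∀ z, χ₁ (x + P * z) * χ₂ (1 - (x + P * z)) =
            χ₁ x * χ₂ (1 - x) * ZMod.stdAddChar (z * ((s₁ * y - s₂ * w) * P)) := by
          intro z
          have e1 : x + P * z = x * (1 + P * (y * z)) := by
            linear_combination -(P * z) * hy'
          have e3 : 1 - (x + P * z) = (1 - x) * (1 + P * (-(w * z))) := by
            linear_combination (P * z) * hw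
          rw [e3, e1, map_mul, map_mul, h₁, h₂, mul_mul_mul_comm, ← AddChar.map_add_eq_mul]
          congr 2
          ring
        simp_rw [h3]
        rw [← mul_sum, AddChar.sum_mulShift _ (ZMod.isPrimitive_stdAddChar q), ZMod.card]
        have hiff : (s₁ * y - s₂ * w) * P = 0 ↔ P * (x - x₀) = 0 := by
          have e : (s₁ * y - s₂ * w) * P = -(y * w * (s₁ + s₂)) * (P * (x - x₀)) := by
            linear_combination -(P * y * w) * hx₀ + (P * s₂ * w) * hy' - (P * s₁ * y) * hw
          have hu : IsUnit (-(y * w * (s₁ + s₂))) :=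
            (((IsUnit.of_mul_eq_one x (by rw [mul_comm, hy'])).mul
              (IsUnit.of_mul_eq_one (1 - x) (by rw [mul_comm, hw]))).mul hs).neg
          rw [e, hu.mul_right_eq_zero]
        simp only [hiff]
        split_ifs <;> simp [mul_comm]
      · have : ∀ z, χ₂ (1 - (x + P * z)) = 0 := fun z => by
          rw [e2]
          exact χ₂.map_nonunit fun h => hy ((isUnit_add_mul_iff hP _ _).1 h)
        simp [this, χ₂.map_nonunit hy]
    · have : ∀ z, χ₁ (x + P * z) = 0 := fun z =>
        χ₁.map_nonunit fun h => hx ((isUnit_add_mul_iff hP _ _).1 h)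
      simp [this, χ₁.map_nonunit hx]
  have hq : (q : ℂ) ≠ 0 := Nat.cast_ne_zero.2 (NeZero.ne q)
  apply mul_left_cancel₀ hq
  calc (q : ℂ) * Jsum2 χ₁ χ₂ 1
      = ∑ z : ZMod q, ∑ x, χ₁ (x + P * z) * χ₂ (1 - (x + P * z)) := by
        have : ∀ z, ∑ x, χ₁ (x + P * z) * χ₂ (1 - (x + P * z)) = Jsum2 χ₁ χ₂ 1 := fun z =>
          Equiv.sum_comp (Equiv.addRight (P * z)) fun x => χ₁ x * χ₂ (1 - x)
        simp [this, ZMod.card]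
    _ = ∑ x : ZMod q, if P * (x - x₀) = 0 then (q : ℂ) * (χ₁ x * χ₂ (1 - x)) else 0 := by
        rw [sum_comm]
        exact sum_congr rfl fun x _ => key x
    _ = ∑ d : ZMod q, if P * d = 0 then (q : ℂ) * (χ₁ (x₀ + d) * χ₂ (1 - (x₀ + d))) else 0 := by
        rw [← Equiv.sum_comp (Equiv.addLeft x₀)]
        simp
    _ = _ := by rw [mul_sum, sum_filter]

end StationaryPhase

section Evaluation

open Finset

theorem two_mul_cast_choose_two {R : Type*} [CommRing R] (c : ℕ) :
    (2 : R) * (c.choose 2 : R) = c * (c - 1) := by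
  induction c with
  | zero => simp
  | succ c ih =>
    rw [Nat.choose_succ_succ' c 1, Nat.choose_one_right]
    push_cast
    linear_combination ih

/-- The coefficient of `z ^ 2` in `(1 + c₂ z) ^ c₁ (1 - c₁ z) ^ c₂`. -/
def quadCoeff (c₁ c₂ : ℕ) : ℤ :=
  c₁.choose 2 * c₂ ^ 2 + c₂.choose 2 * c₁ ^ 2 - c₁ ^ 2 * c₂ ^ 2

theorem two_mul_quadCoeff (c₁ c₂ : ℕ) : 2 * quadCoeff c₁ c₂ = -(c₁ * c₂ * (c₁ + c₂)) := by
  have h₁ := two_mul_cast_choose_two (R := ℤ) c₁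
  have h₂ := two_mul_cast_choose_two (R := ℤ) c₂
  rw [quadCoeff]
  linear_combination (c₂ : ℤ) ^ 2 * h₁ + (c₁ : ℤ) ^ 2 * h₂

theorem one_add_pow_mul_one_sub_pow {R : Type*} [CommRing R] {z : R} (hz : z ^ 3 = 0)
    (c₁ c₂ : ℕ) :
    (1 + c₂ * z) ^ c₁ * (1 - c₁ * z) ^ c₂ = 1 + quadCoeff c₁ c₂ * z ^ 2 := by
  obtain ⟨q₁, h₁⟩ := one_add_pow_eq (c₂ * z) c₁
  obtain ⟨q₂, h₂⟩ := one_add_pow_eq (-(c₁ * z)) c₂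
  have e₁ : (1 + c₂ * z) ^ c₁ = 1 + c₁ * c₂ * z + c₁.choose 2 * c₂ ^ 2 * z ^ 2 := by
    rw [h₁]
    linear_combination (c₂ : R) ^ 3 * q₁ * hz
  have e₂ : (1 - c₁ * z) ^ c₂ = 1 - c₁ * c₂ * z + c₂.choose 2 * c₁ ^ 2 * z ^ 2 := by
    rw [sub_eq_add_neg, h₂]
    linear_combination -(c₁ : R) ^ 3 * q₂ * hz
  rw [e₁, e₂, quadCoeff]
  push_cast
  linear_combination (c₁ * c₂ * (c₂.choose 2 * c₁ ^ 2 - c₁.choose 2 * c₂ ^ 2)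
    + c₁.choose 2 * c₂ ^ 2 * c₂.choose 2 * c₁ ^ 2 * z : R) * hz

theorem stdAddChar_pow_mul {p l : ℕ} [NeZero p] (x : ZMod (p ^ (l + 1))) :
    ZMod.stdAddChar ((p : ZMod (p ^ (l + 1))) ^ l * x) =
      ZMod.stdAddChar (ZMod.castHom (dvd_pow_self p l.succ_ne_zero) (ZMod p) x) := by
  obtain ⟨j, rfl⟩ := ZMod.intCast_surjective x
  have h : (p : ZMod (p ^ (l + 1))) ^ l * j = (((p : ℤ) ^ l * j : ℤ) : ZMod (p ^ (l + 1))) := by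
    push_cast
    rfl
  have hp : (p : ℂ) ≠ 0 := Nat.cast_ne_zero.2 (NeZero.ne p)
  rw [h, map_intCast (ZMod.castHom _ (ZMod p)), ZMod.stdAddChar_coe, ZMod.stdAddChar_coe]
  congr 1
  push_cast
  field_simp
  ring

theorem sum_stdAddChar_pow_mul_sq {p l : ℕ} [Fact p.Prime] (hp2 : p ≠ 2)
    {s : ZMod (p ^ (l + 1))}
    (hs : ZMod.castHom (dvd_pow_self p l.succ_ne_zero) (ZMod p) s ≠ 0) :
    ∑ t, ZMod.stdAddChar ((p : ZMod (p ^ (l + 1))) ^ l * (s * t ^ 2)) =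
      p ^ l * (quadC p (ZMod.castHom (dvd_pow_self p l.succ_ne_zero) (ZMod p) s) *
        (eps p * (Real.sqrt p : ℂ))) := by
  set f := ZMod.castHom (dvd_pow_self p l.succ_ne_zero) (ZMod p)
  have hp : (p : ℂ) ≠ 0 := Nat.cast_ne_zero.2 (NeZero.ne p)
  have h := card_mul_sum_comp_eq (f := f.toAddMonoidHom) (ZMod.ringHom_surjective f)
    fun t => ZMod.stdAddChar (f s * t ^ 2)
  simp_rw [stdAddChar_pow_mul, map_mul, map_pow]
  rw [← sum_stdAddChar_mul_sq p hp2 hs]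
  apply mul_left_cancel₀ hp
  rw [ZMod.card, ZMod.card] at h
  refine h.trans ?_
  rw [Nat.cast_pow, pow_succ]
  ring

theorem pow_mul_Jsum2_one {p n k : ℕ} [NeZero (p ^ (n + k))] (hp : p.Prime) (hp2 : p ≠ 2)
    (hn : 1 ≤ n) (hnk : n ≤ k) (hkn : k ≤ 2 * n) {a : ℕ} {r : ℤ}
    (hr : (a : ℤ) ^ (p - 1) = 1 + r * p) (hpr : ¬ (p : ℤ) ∣ r)
    {θ : DirichletCharacter ℂ (p ^ (n + k))}
    (hθ : θ (a : ZMod (p ^ (n + k))) =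
      Complex.exp (2 * Real.pi * Complex.I / Nat.totient (p ^ (n + k))))
    {c₁ c₂ : ℕ} (hc₁ : IsUnit (c₁ : ZMod (p ^ (n + k)))) (hc₂ : IsUnit (c₂ : ZMod (p ^ (n + k))))
    {y : ZMod (p ^ (n + k))} (hy : (c₁ + c₂ : ZMod (p ^ (n + k))) * y = 1) :
    (p : ℂ) ^ n * Jsum2 (θ ^ c₁) (θ ^ c₂) 1 =
      (θ ^ c₁) (c₁ * y) * (θ ^ c₂) (c₂ * y) *
        ∑ t, θ (1 + (p : ZMod (p ^ (n + k))) ^ (2 * n) * (quadCoeff c₁ c₂ * t ^ 2)) := by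
  have hz : (p : ZMod (p ^ (n + k))) ^ (n + k) = 0 := by
    exact_mod_cast ZMod.natCast_self (p ^ (n + k))
  have hz3 : (p : ZMod (p ^ (n + k))) ^ (3 * n) = 0 := pow_eq_zero_of_le (by omega) hz
  obtain ⟨ρ, -, hρ, -, hθρ⟩ := character_one_add_eq_stdAddChar hp hp2 hr hpr hθ
    (k := k) (by omega) (by omega) (by omega)
  have hpow : ∀ (c : ℕ) (u : ZMod (p ^ (n + k))),
      (θ ^ c) (1 + (p : ZMod (p ^ (n + k))) ^ k * u) =
        ZMod.stdAddChar (ρ * (c : ZMod (p ^ (n + k))) * (p : ZMod (p ^ (n + k))) ^ k * u) := by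
    intro c u
    have hu : IsUnit (1 + (p : ZMod (p ^ (n + k))) ^ k * u) :=
      (isUnit_add_mul_iff ⟨n + k, by rw [← pow_mul]; exact pow_eq_zero_of_le (by nlinarith) hz⟩
        _ _).2 isUnit_one
    obtain ⟨v, hv⟩ := hu
    rw [← hv, MulChar.pow_apply_coe, hv, hθρ, ← AddChar.map_nsmul_eq_pow, nsmul_eq_mul]
    congr 1
    ring
  have hys : IsUnit (c₁ + c₂ : ZMod (p ^ (n + k))) := IsUnit.of_mul_eq_one _ hy
  rw [Jsum2_one_eq_sum_filter (x₀ := (c₁ : ZMod (p ^ (n + k))) * y)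
    ⟨n + k, by rw [← pow_mul]; exact pow_eq_zero_of_le (by nlinarith) hz⟩ _ _
    (hpow c₁) (hpow c₂) (by rw [← mul_add]; exact hρ.mul hys)
    (by linear_combination ρ * (c₁ : ZMod (p ^ (n + k))) * hy),
    ← sum_comp_pow_mul hp.ne_zero
      fun d => (θ ^ c₁) ((c₁ : ZMod (p ^ (n + k))) * y + d) *
        (θ ^ c₂) (1 - ((c₁ : ZMod (p ^ (n + k))) * y + d)),
    mul_sum]
  have hyu : IsUnit y := IsUnit.of_mul_eq_one _ ((mul_comm _ _).trans hy)
  obtain ⟨v, hv⟩ := (hc₁.mul hc₂).mul hyu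
  rw [← Equiv.sum_comp (Units.mulLeft v)]
  refine sum_congr rfl fun t _ => ?_
  set P : ZMod (p ^ (n + k)) := (p : ZMod (p ^ (n + k))) ^ n with hPdef
  have hP3 : P ^ 3 = 0 := by rw [hPdef, ← pow_mul, mul_comm, hz3]
  have e₁ : c₁ * y + P * (c₁ * c₂ * y * t) =
      c₁ * y * (1 + c₂ * (P * t)) := by ring
  have e₂ : 1 - c₁ * y * (1 + c₂ * (P * t)) =
      c₂ * y * (1 - c₁ * (P * t)) := by
    linear_combination -hy
  have hnil : IsNilpotent P := ⟨3, hP3⟩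
  obtain ⟨w₁, hw₁⟩ := (isUnit_add_mul_iff hnil 1 (c₂ * t)).2 isUnit_one
  obtain ⟨w₂, hw₂⟩ := (isUnit_add_mul_iff hnil 1 (-(c₁ * t))).2 isUnit_one
  have e₃ : 1 + c₂ * (P * t) = w₁ := by rw [hw₁]; ring
  have e₄ : 1 - c₁ * (P * t) = w₂ := by rw [hw₂]; ring
  rw [Units.mulLeft_apply, hv, e₁, e₂, map_mul (θ ^ c₁) (_ * y), map_mul (θ ^ c₂) (_ * y),
    mul_mul_mul_comm]
  congr 1
  rw [e₃, e₄, MulChar.pow_apply_coe, MulChar.pow_apply_coe, ← map_pow, ← map_pow, ← map_mul,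
    ← e₃, ← e₄, one_add_pow_mul_one_sub_pow (by rw [mul_pow, hP3, zero_mul])]
  congr 1
  rw [hPdef]
  ring

theorem jacobiSym_eq_quadC {p : ℕ} [Fact p.Prime] (s : ℤ) :
    (jacobiSym s p : ℂ) = quadC p s := by
  rw [← jacobiSym.legendreSym.to_jacobiSym]
  rfl

theorem quadC_mul_self {p : ℕ} [Fact p.Prime] {x : ZMod p} (hx : x ≠ 0) :
    quadC p x * quadC p x = 1 := by
  have := quadraticChar_sq_one hx
  rw [sq] at this
  have h := congrArg (Int.cast : ℤ → ℂ) this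
  rwa [Int.cast_mul, Int.cast_one] at h

theorem eps_odd_pow {p : ℕ} (hp : p % 2 = 1) (n : ℕ) : eps (p ^ (2 * n + 1)) = eps p := by
  have h : p ^ (2 * n + 1) % 4 = p % 4 := by
    have h2 : p ^ 2 % 4 = 1 := by
      rcases (by omega : p % 4 = 1 ∨ p % 4 = 3) with h | h <;> simp [Nat.pow_mod, h]
    rw [pow_succ, pow_mul, Nat.mul_mod, Nat.pow_mod, h2]
    simp
  rw [eps, eps, h]

theorem eps_even_pow {p : ℕ} (hp : p % 2 = 1) (n : ℕ) : eps (p ^ (2 * n)) = 1 := by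
  have h2 : p ^ 2 % 4 = 1 := by
    rcases (by omega : p % 4 = 1 ∨ p % 4 = 3) with h | h <;> simp [Nat.pow_mod, h]
  rw [eps, if_pos (by rw [pow_mul, Nat.pow_mod, h2]; simp)]

theorem jacobiSym_pow_even {p : ℕ} [Fact p.Prime] {s : ℤ} (hs : (s : ZMod p) ≠ 0) (n : ℕ) :
    (jacobiSym s p : ℂ) ^ (2 * n) = 1 := by
  rw [jacobiSym_eq_quadC, pow_mul, sq, quadC_mul_self hs, one_pow]

theorem quadC_mul_quadCoeff {p : ℕ} [Fact p.Prime] {c₁ c₂ : ℕ} {r : ℤ} {ρ : ZMod p}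
    (hρ : ρ * r = 1) (hr : ((-2 * r : ℤ) : ZMod p) ≠ 0)
    (hc : ((c₁ * c₂ * (c₁ + c₂) : ℤ) : ZMod p) ≠ 0) :
    ρ * quadCoeff c₁ c₂ ≠ 0 ∧ quadC p (ρ * quadCoeff c₁ c₂) =
      (jacobiSym (-2 * r) p : ℂ) * (jacobiSym ((c₁ : ℤ) * c₂ * (c₁ + c₂)) p : ℂ) := by
  rw [jacobiSym_eq_quadC, jacobiSym_eq_quadC]
  set N : ZMod p := ((c₁ * c₂ * (c₁ + c₂) : ℤ) : ZMod p) with hN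
  set u : ZMod p := ((-2 * r : ℤ) : ZMod p) with hu
  have hD : u * (ρ * quadCoeff c₁ c₂) = N := by
    have h := congrArg (Int.cast : ℤ → ZMod p) (two_mul_quadCoeff c₁ c₂)
    rw [hu, hN]
    push_cast at h ⊢
    linear_combination -2 * (quadCoeff c₁ c₂ : ZMod p) * hρ - h
  refine ⟨right_ne_zero_of_mul (hD ▸ hc), ?_⟩
  rw [← hD, map_mul _ u, ← mul_assoc, quadC_mul_self hr, one_mul]

theorem Jsum2_one_eq {p m : ℕ} [NeZero (p ^ m)] (hp : p.Prime) (hp2 : p ≠ 2) (hm : 2 ≤ m)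
    {a : ℕ} {r : ℤ} (hr : (a : ℤ) ^ (p - 1) = 1 + r * p) (hpr : ¬ (p : ℤ) ∣ r)
    {θ : DirichletCharacter ℂ (p ^ m)}
    (hθ : θ (a : ZMod (p ^ m)) = Complex.exp (2 * Real.pi * Complex.I / Nat.totient (p ^ m)))
    {c₁ c₂ : ℕ} (hpc : ¬ p ∣ c₁ * c₂ * (c₁ + c₂)) {y : ZMod (p ^ m)}
    (hy : (c₁ + c₂ : ZMod (p ^ m)) * y = 1) :
    Jsum2 (θ ^ c₁) (θ ^ c₂) 1 =
      (θ ^ c₁) (c₁ * y) * (θ ^ c₂) (c₂ * y) * ((Real.sqrt p : ℂ) ^ m *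
        (jacobiSym (-2 * r) p : ℂ) ^ m *
        (jacobiSym ((c₁ : ℤ) * c₂ * (c₁ + c₂)) p : ℂ) ^ m * eps (p ^ m)) := by
  have : Fact p.Prime := ⟨hp⟩
  have hpodd : p % 2 = 1 := Nat.odd_iff.1 (hp.odd_of_ne_two hp2)
  have hp0 : (p : ℂ) ≠ 0 := Nat.cast_ne_zero.2 hp.ne_zero
  have hsqrt : (Real.sqrt p : ℂ) ^ 2 = p := by
    exact_mod_cast Real.sq_sqrt (Nat.cast_nonneg (α := ℝ) p)
  have hunit : ∀ c : ℕ, ¬ p ∣ c → IsUnit (c : ZMod (p ^ m)) := fun c hc => by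
    exact_mod_cast isUnit_intCast_of_not_dvd (m := m) (s := c) hp (by exact_mod_cast hc)
  have hc₁ := hunit c₁ fun h => hpc ((h.mul_right _).mul_right _)
  have hc₂ := hunit c₂ fun h => hpc ((h.mul_left _).mul_right _)
  have hN : ((c₁ * c₂ * (c₁ + c₂) : ℤ) : ZMod p) ≠ 0 := by
    rw [Ne, ZMod.intCast_zmod_eq_zero_iff_dvd]
    exact_mod_cast hpc
  have hr0 : ((-2 * r : ℤ) : ZMod p) ≠ 0 := by
    rw [Ne, ZMod.intCast_zmod_eq_zero_iff_dvd, neg_mul, dvd_neg]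
    intro h
    rcases (Nat.prime_iff_prime_int.1 hp).dvd_or_dvd h with h | h
    · exact hp2 ((Nat.prime_dvd_prime_iff_eq hp Nat.prime_two).1 (by exact_mod_cast h))
    · exact hpr h
  obtain ⟨n, rfl | rfl⟩ : ∃ n, m = n + n ∨ m = n + (n + 1) := ⟨m / 2, by omega⟩
  · have h := pow_mul_Jsum2_one hp hp2 (by omega) le_rfl (by omega) hr hpr hθ hc₁ hc₂ hy
    have hz : (p : ZMod (p ^ (n + n))) ^ (2 * n) = 0 := by
      rw [two_mul]
      exact_mod_cast ZMod.natCast_self (p ^ (n + n))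
    simp only [hz, zero_mul, add_zero, map_one, sum_const, card_univ, ZMod.card, nsmul_eq_mul,
      mul_one] at h
    have hrhs : (Real.sqrt p : ℂ) ^ (n + n) * (jacobiSym (-2 * r) p : ℂ) ^ (n + n) *
        (jacobiSym ((c₁ : ℤ) * c₂ * (c₁ + c₂)) p : ℂ) ^ (n + n) * eps (p ^ (n + n)) = p ^ n := by
      rw [← two_mul, jacobiSym_pow_even hr0, jacobiSym_pow_even hN, eps_even_pow hpodd, pow_mul,
        hsqrt]
      ring
    apply mul_left_cancel₀ (pow_ne_zero n hp0)
    rw [h, hrhs]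
    push_cast
    ring
  · have h := pow_mul_Jsum2_one hp hp2 (by omega) (by omega) (by omega) hr hpr hθ hc₁ hc₂ hy
    obtain ⟨ρ, w, -, hρr, hθρ⟩ := character_one_add_eq_stdAddChar hp hp2 hr hpr hθ
      (k := 2 * n) (by omega) (by omega) (by omega)
    set f : ZMod (p ^ (n + (n + 1))) →+* ZMod p :=
      ZMod.castHom (dvd_pow_self p (n + n).succ_ne_zero) (ZMod p) with hf
    have hfρ : f ρ * r = 1 := by simpa using congrArg f hρr
    obtain ⟨hne, hquad⟩ := quadC_mul_quadCoeff hfρ hr0 hN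
    have hfD : f (ρ * quadCoeff c₁ c₂) = f ρ * quadCoeff c₁ c₂ := by rw [map_mul, map_intCast]
    have hsum : ∑ t, θ (1 + (p : ZMod (p ^ (n + (n + 1)))) ^ (2 * n) *
        (quadCoeff c₁ c₂ * t ^ 2)) =
        p ^ (n + n) * (quadC p (f (ρ * quadCoeff c₁ c₂)) * (eps p * (Real.sqrt p : ℂ))) := by
      refine Eq.trans (sum_congr rfl fun t _ => ?_)
        (sum_stdAddChar_pow_mul_sq (l := n + n) hp2 (s := ρ * quadCoeff c₁ c₂) (hfD ▸ hne))
      rw [hθρ, two_mul]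
      congr 1
      change _ = (p : ZMod (p ^ (n + (n + 1)))) ^ (n + n) * (ρ * quadCoeff c₁ c₂ * t ^ 2)
      ring
    have hrhs : (Real.sqrt p : ℂ) ^ (n + (n + 1)) * (jacobiSym (-2 * r) p : ℂ) ^ (n + (n + 1)) *
        (jacobiSym ((c₁ : ℤ) * c₂ * (c₁ + c₂)) p : ℂ) ^ (n + (n + 1)) *
        eps (p ^ (n + (n + 1))) = p ^ n * (Real.sqrt p * (jacobiSym (-2 * r) p *
          jacobiSym ((c₁ : ℤ) * c₂ * (c₁ + c₂)) p) * eps p) := by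
      rw [← add_assoc, ← two_mul, pow_succ, pow_succ, pow_succ, jacobiSym_pow_even hr0,
        jacobiSym_pow_even hN, eps_odd_pow hpodd, pow_mul, hsqrt]
      ring
    apply mul_left_cancel₀ (pow_ne_zero n hp0)
    rw [h, hsum, hfD, hquad, hrhs]
    ring

end Evaluation

theorem stmt17 {p m : ℕ} [NeZero (p ^ m)] (hp : p.Prime) (hp2 : p ≠ 2) (hm : 2 ≤ m)
    -- a primitive root a mod p^m
    (a : ℕ) (ha : orderOf (a : ZMod (p ^ m)) = Nat.totient (p ^ m))
    -- r with a^(p-1) = 1 + r p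
    (r : ℤ) (hr : (a : ℤ) ^ (p - 1) = 1 + r * p)
    (χ₁ χ₂ : DirichletCharacter ℂ (p ^ m))
    -- c₁, c₂ with χ_i(a) = e(c_i/φ(p^m)), 1 ≤ c_i ≤ φ(p^m)
    (c₁ c₂ : ℕ)
    (hc₁ : 1 ≤ c₁ ∧ c₁ ≤ Nat.totient (p ^ m)) (hc₂ : 1 ≤ c₂ ∧ c₂ ≤ Nat.totient (p ^ m))
    (hχ₁ : χ₁ (a : ZMod (p ^ m)) =
      Complex.exp (2 * Real.pi * Complex.I * c₁ / (Nat.totient (p ^ m))))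
    (hχ₂ : χ₂ (a : ZMod (p ^ m)) =
      Complex.exp (2 * Real.pi * Complex.I * c₂ / (Nat.totient (p ^ m))))
    (b : ℤ) (hb : ¬ (p : ℤ) ∣ b)
    (hpc : ¬ p ∣ c₁ * c₂ * (c₁ + c₂)) :
    Jsum2 χ₁ χ₂ ((b : ℤ) : ZMod (p ^ m)) =
      (χ₁ * χ₂) ((b : ℤ) : ZMod (p ^ m)) * χ₁ ((c₁ : ZMod (p ^ m))) *
        χ₂ ((c₂ : ZMod (p ^ m))) * ((χ₁ * χ₂) (((c₁ + c₂ : ℕ) : ZMod (p ^ m))))⁻¹ *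
        (Real.sqrt p : ℂ) ^ m *
        (jacobiSym (-2 * r) p : ℂ) ^ m *
        (jacobiSym ((c₁ : ℤ) * c₂ * (c₁ + c₂)) p : ℂ) ^ m *
        eps (p ^ m) := by
  obtain ⟨θ, hθ, hall⟩ := exists_generating_character ha
  obtain rfl := hall χ₁ c₁ hχ₁
  obtain rfl := hall χ₂ c₂ hχ₂
  have hs : IsUnit ((c₁ + c₂ : ℕ) : ZMod (p ^ m)) := by
    have h : ¬ p ∣ c₁ + c₂ := fun h => hpc (h.mul_left _)
    exact_mod_cast isUnit_intCast_of_not_dvd (m := m) (s := (c₁ + c₂ : ℕ)) hp (by exact_mod_cast h)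
  obtain ⟨y, hy⟩ := hs.exists_right_inv
  have hinv : ((θ ^ c₁ * θ ^ c₂) ((c₁ + c₂ : ℕ) : ZMod (p ^ m)))⁻¹ = (θ ^ c₁ * θ ^ c₂) y :=
    inv_eq_of_mul_eq_one_right (by rw [← map_mul, hy, map_one])
  push_cast at hy
  rw [Jsum2_eq_mul_Jsum2_one _ _ (isUnit_intCast_of_not_dvd hp hb),
    Jsum2_one_eq hp hp2 hm hr (not_dvd_of_orderOf_eq hp hp2 hm ha hr) hθ hpc hy, hinv,
    MulChar.mul_apply _ _ y, map_mul, map_mul]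
  ring
end
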